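/- arXiv:0905.0270 — 5 statements merged into one kernel-verified Lean document; each statement's English description precedes it below -/
import Mathlib

section
/- Let d ≥ 3. There exists a constant c_d > 0, depending only on d, such that for every finitely supported function u : ℤ^d → ℂ one has Q_0[u] ≥ c_d · Σ_{x ∈ ℤ^d} |u(x)|² / (|x|² + 1). -/
open scoped ENNReal NNReal Topology
open Filter MeasureTheory

noncomputable section

/-- The lattice point `1_j` in `ℤ^d`: `j`-th coordinate `1`, all others `0`. -/
def latUnit (d : ℕ) (j : Fin d) : Fin d → ℤ := fun i => if i = j then 1 else 0

/-- The discrete Dirichlet form `Q_0[u] = Σ_x Σ_j |u(x+1_j) − u(x)|²`, valued in `[0,∞]`. -/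
def Q0 {d : ℕ} (u : (Fin d → ℤ) → ℂ) : ℝ≥0∞ :=
  ∑' x : Fin d → ℤ, ∑ j : Fin d, ((‖u (x + latUnit d j) - u x‖₊ : ℝ≥0∞)) ^ 2

/-- `b_V[u] = Σ_x V(x)|u(x)|²`, valued in `[0,∞]`. -/
def bV {d : ℕ} (V : (Fin d → ℤ) → ℝ) (u : (Fin d → ℤ) → ℂ) : ℝ≥0∞ :=
  ∑' x : Fin d → ℤ, ENNReal.ofReal (V x) * ((‖u x‖₊ : ℝ≥0∞)) ^ 2

/-- The Euclidean norm `|x|` of a lattice point. -/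
def znorm {d : ℕ} (x : Fin d → ℤ) : ℝ := Real.sqrt (∑ i, ((x i : ℝ)) ^ 2)

/-- The regularised square norm `|x|² + 40 d²`. -/
def regSq {d : ℕ} (x : Fin d → ℤ) : ℝ := ∑ i, (x i : ℝ) ^ 2 + 40 * (d : ℝ) ^ 2

lemma sq_add_le_regSq {d : ℕ} (x : Fin d → ℤ) (j : Fin d) :
    (x j : ℝ) ^ 2 + 40 * (d : ℝ) ^ 2 ≤ regSq x := by
  have := Finset.single_le_sum (f := fun i => (x i : ℝ) ^ 2) (fun i _ => sq_nonneg _)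
    (Finset.mem_univ j)
  simp only [regSq]
  linarith

lemma regSq_sub_latUnit {d : ℕ} (x : Fin d → ℤ) (j : Fin d) :
    regSq (x - latUnit d j) = regSq x - 2 * (x j : ℝ) + 1 := by
  have h : ∀ i, (((x - latUnit d j) i : ℤ) : ℝ) ^ 2
      = (x i : ℝ) ^ 2 + if i = j then -2 * (x j : ℝ) + 1 else 0 := by
    intro i
    by_cases hij : i = j
    · subst hij
      simp [latUnit]
      ring
    · simp [latUnit, hij]
  simp only [regSq, h, Finset.sum_add_distrib, Finset.sum_ite_eq', Finset.mem_univ, if_true]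
  ring

/-- The vector field `x / (|x|² + 40 d²)`, whose discrete divergence drives the Hardy inequality. -/
def hardyField {d : ℕ} (j : Fin d) (x : Fin d → ℤ) : ℝ := x j / regSq x

lemma divergence_term_lower_bound {a r d : ℝ} (hd : 1 ≤ d) (hr : a ^ 2 + 40 * d ^ 2 ≤ r) :
    (r - 2 * a ^ 2) / r ^ 2 - 3 / (4 * d) / r ≤
      a / r - (a / r) ^ 2 / (12 * d)
        - ((a - 1) / (r - 2 * a + 1) + ((a - 1) / (r - 2 * a + 1)) ^ 2 / (12 * d)) := by
  have hd2 : 1 ≤ d ^ 2 := by nlinarith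
  have hr0 : 0 < r := by nlinarith [sq_nonneg a]
  obtain ⟨q, hq⟩ : ∃ q, q = r - 2 * a + 1 := ⟨_, rfl⟩
  rw [← hq]
  have hqr : r / 2 ≤ q := by nlinarith [sq_nonneg (a - 2)]
  have hq0 : 0 < q := by linarith
  have h1 : (a / r) ^ 2 ≤ 1 / r := by
    rw [div_pow, div_le_div_iff₀ (by positivity) hr0]
    nlinarith
  have h2 : ((a - 1) / q) ^ 2 ≤ 2 / r := by
    rw [div_pow, div_le_div_iff₀ (by positivity) hr0]
    have : (a - 1) ^ 2 ≤ q := by nlinarith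
    nlinarith [mul_le_mul this hqr (by positivity) hq0.le]
  have h3 : (r - 2 * a ^ 2) / r ^ 2 - 1 / (2 * d) / r ≤ a / r - (a - 1) / q := by
    have key : a / r - (a - 1) / q - (r - 2 * a ^ 2) / r ^ 2
        = (a * r - (r - 2 * a ^ 2) * (1 - 2 * a)) / (r ^ 2 * q) := by
      field_simp
      rw [hq]
      ring
    have hs : |r - 2 * a ^ 2| ≤ r := by
      rw [abs_le]
      constructor <;> nlinarith [sq_nonneg a]
    have ht : |1 - 2 * a| ≤ 1 + 2 * |a| := by
      refine (abs_sub _ _).trans ?_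
      simp [abs_mul]
    have hn : |a * r - (r - 2 * a ^ 2) * (1 - 2 * a)| ≤ r * (1 + 3 * |a|) := by
      refine (abs_sub _ _).trans ?_
      rw [abs_mul, abs_mul, abs_of_pos hr0]
      nlinarith [mul_le_mul hs ht (abs_nonneg _) hr0.le]
    have hm : 4 * d * (1 + 3 * |a|) ≤ r := by
      nlinarith [sq_nonneg (|a| - 6 * d), sq_abs a]
    have hb : -(1 / (2 * d) / r)
        ≤ (a * r - (r - 2 * a ^ 2) * (1 - 2 * a)) / (r ^ 2 * q) := by
      rw [le_div_iff₀ (by positivity)]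
      have e : -(1 / (2 * d) / r) * (r ^ 2 * q) = -(r * q / (2 * d)) := by
        field_simp
      rw [e]
      have : r * (1 + 3 * |a|) ≤ r * q / (2 * d) := by
        rw [le_div_iff₀ (by positivity)]
        nlinarith
      linarith [(abs_le.1 hn).1]
    linarith
  have h4 : (a / r) ^ 2 / (12 * d) + ((a - 1) / q) ^ 2 / (12 * d) ≤ 1 / (4 * d) / r := by
    rw [← add_div, div_le_iff₀ (by positivity)]
    have e : 1 / (4 * d) / r * (12 * d) = 1 / r + 2 / r := by
      field_simp
      norm_num
    linarith
  have e : 3 / (4 * d) / r = 1 / (2 * d) / r + 1 / (4 * d) / r := by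
    field_simp
    norm_num
  linarith

lemma hardyField_divergence {d : ℕ} (hd : 3 ≤ d) (x : Fin d → ℤ) :
    1 / (4 * regSq x) ≤ ∑ j, (hardyField j x - hardyField j x ^ 2 / (12 * d)
      - (hardyField j (x - latUnit d j) + hardyField j (x - latUnit d j) ^ 2 / (12 * d))) := by
  have hd' : (3 : ℝ) ≤ d := by exact_mod_cast hd
  have hr : 0 < regSq x := by
    unfold regSq
    positivity
  calc 1 / (4 * regSq x)
      ≤ ∑ j, ((regSq x - 2 * (x j : ℝ) ^ 2) / regSq x ^ 2 - 3 / (4 * d) / regSq x) := by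
        rw [Finset.sum_sub_distrib, ← Finset.sum_div, Finset.sum_sub_distrib, ← Finset.mul_sum]
        simp only [Finset.sum_const, Finset.card_univ, Fintype.card_fin, nsmul_eq_mul]
        have hs : ∑ i, (x i : ℝ) ^ 2 ≤ regSq x := by
          unfold regSq
          linarith [sq_nonneg (d : ℝ)]
        have e : (d : ℝ) * (3 / (4 * d) / regSq x) = 3 / 4 / regSq x := by
          field_simp
        have h : (1 : ℝ) / regSq x
            ≤ (d * regSq x - 2 * ∑ i, (x i : ℝ) ^ 2) / regSq x ^ 2 := by
          rw [div_le_div_iff₀ hr (by positivity)]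
          nlinarith [mul_le_mul_of_nonneg_right hd' hr.le]
        have e' : 1 / (4 * regSq x) = 1 / regSq x - 3 / 4 / regSq x := by
          field_simp
          norm_num
        linarith
    _ ≤ _ := by
        refine Finset.sum_le_sum fun j _ => ?_
        have := divergence_term_lower_bound (by linarith : (1 : ℝ) ≤ d) (sq_add_le_regSq x j)
        simpa [hardyField, regSq_sub_latUnit, latUnit] using this

lemma weighted_norm_sq_sub_le {l : ℝ} (hl : 0 < l) (f : ℝ) (z w : ℂ) :
    ‖z‖ ^ 2 * (f - f ^ 2 / (2 * l)) - ‖w‖ ^ 2 * (f + f ^ 2 / (2 * l)) ≤ l * ‖w - z‖ ^ 2 := by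
  have h : (‖w‖ - ‖z‖) ^ 2 ≤ ‖w - z‖ ^ 2 := by
    rw [← sq_abs]
    exact pow_le_pow_left₀ (abs_nonneg _) (abs_norm_sub_norm_le w z) 2
  have h' : 0 ≤ l * (‖w‖ - ‖z‖) ^ 2 + f * (‖w‖ - ‖z‖) * (‖w‖ + ‖z‖)
      + f ^ 2 / (2 * l) * (‖w‖ ^ 2 + ‖z‖ ^ 2) := by
    have e : l * (‖w‖ - ‖z‖) ^ 2 + f * (‖w‖ - ‖z‖) * (‖w‖ + ‖z‖)
        + f ^ 2 / (2 * l) * (‖w‖ ^ 2 + ‖z‖ ^ 2)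
        = (2 * l * (‖w‖ - ‖z‖) + f * (‖w‖ + ‖z‖)) ^ 2 / (4 * l)
          + f ^ 2 / (4 * l) * (‖w‖ - ‖z‖) ^ 2 := by
      field_simp
      ring
    rw [e]
    positivity
  nlinarith [mul_le_mul_of_nonneg_left h hl.le]

lemma summable_norm_sq_mul {α : Type*} {u : α → ℂ} (hu : (Function.support u).Finite)
    (g : α → ℝ) : Summable fun x => ‖u x‖ ^ 2 * g x := by
  refine summable_of_hasFiniteSupport (hu.subset fun x hx => ?_)
  contrapose! hx
  simp_all

lemma support_comp_add_finite {α : Type*} [AddGroup α] {u : α → ℂ}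
    (hu : (Function.support u).Finite) (e : α) :
    (Function.support fun x => u (x + e)).Finite :=
  hu.preimage (add_left_injective e).injOn

lemma summable_norm_sq_diff {α : Type*} [AddGroup α] {u : α → ℂ}
    (hu : (Function.support u).Finite) (e : α) :
    Summable fun x => ‖u (x + e) - u x‖ ^ 2 := by
  have h : (Function.support fun x => u (x + e) - u x).Finite :=
    ((support_comp_add_finite hu e).union hu).subset (Function.support_sub _ _)
  simpa using summable_norm_sq_mul h fun _ => 1

lemma tsum_shifted_weight_le {α : Type*} [AddGroup α] {u : α → ℂ}
    (hu : (Function.support u).Finite) (e : α) {l : ℝ} (hl : 0 < l) (f : α → ℝ) :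
    ∑' x, ‖u x‖ ^ 2 * (f x - f x ^ 2 / (2 * l) - (f (x - e) + f (x - e) ^ 2 / (2 * l)))
      ≤ l * ∑' x, ‖u (x + e) - u x‖ ^ 2 := by
  simp only [mul_sub (‖u _‖ ^ 2) (f _ - f _ ^ 2 / (2 * l))]
  rw [Summable.tsum_sub (summable_norm_sq_mul hu _) (summable_norm_sq_mul hu _),
    ← (Equiv.addRight e).tsum_eq fun x => ‖u x‖ ^ 2 * (f (x - e) + f (x - e) ^ 2 / (2 * l))]
  simp only [Equiv.coe_addRight, add_sub_cancel_right]
  have hs := summable_norm_sq_mul (support_comp_add_finite hu e) fun x => f x + f x ^ 2 / (2 * l)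
  rw [← Summable.tsum_sub (summable_norm_sq_mul hu _) hs, ← tsum_mul_left]
  exact Summable.tsum_le_tsum (fun x => weighted_norm_sq_sub_le hl _ _ _)
    ((summable_norm_sq_mul hu _).sub hs) ((summable_norm_sq_diff hu e).mul_left l)

lemma tsum_norm_sq_div_regSq_le {d : ℕ} (hd : 3 ≤ d) {u : (Fin d → ℤ) → ℂ}
    (hu : (Function.support u).Finite) :
    ∑' x, ‖u x‖ ^ 2 * (1 / (4 * regSq x))
      ≤ 6 * d * ∑' x, ∑ j, ‖u (x + latUnit d j) - u x‖ ^ 2 := by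
  have hl : (0 : ℝ) < 6 * d := by
    have : (3 : ℝ) ≤ d := by exact_mod_cast hd
    linarith
  have h12 : (12 : ℝ) * d = 2 * (6 * d) := by ring
  calc ∑' x, ‖u x‖ ^ 2 * (1 / (4 * regSq x))
      ≤ ∑' x, ‖u x‖ ^ 2 * ∑ j, (hardyField j x - hardyField j x ^ 2 / (12 * d)
      - (hardyField j (x - latUnit d j) + hardyField j (x - latUnit d j) ^ 2 / (12 * d))) :=
        Summable.tsum_le_tsum
          (fun x => mul_le_mul_of_nonneg_left (hardyField_divergence hd x) (by positivity))
          (summable_norm_sq_mul hu _) (summable_norm_sq_mul hu _)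
    _ ≤ _ := by
        simp only [Finset.mul_sum, h12]
        rw [Summable.tsum_finsetSum fun j _ => summable_norm_sq_mul hu _,
          Summable.tsum_finsetSum fun j _ => summable_norm_sq_diff hu _, Finset.mul_sum]
        exact Finset.sum_le_sum fun j _ => tsum_shifted_weight_le hu _ hl _

/-- the discrete Hardy inequality on `ℤ^d`, `d ≥ 3`. -/
theorem discrete_hardy_inequality (d : ℕ) (hd : 3 ≤ d) :
    ∃ c : ℝ, 0 < c ∧
      ∀ u : (Fin d → ℤ) → ℂ, (Function.support u).Finite →
        ENNReal.ofReal c *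
            ∑' x : Fin d → ℤ, ((‖u x‖₊ : ℝ≥0∞)) ^ 2 / ENNReal.ofReal (znorm x ^ 2 + 1)
          ≤ Q0 u := by
  have hd' : (3 : ℝ) ≤ d := by exact_mod_cast hd
  refine ⟨1 / (960 * (d : ℝ) ^ 3), by positivity, fun u hu => ?_⟩
  have hQ : Q0 u = ENNReal.ofReal (∑' x, ∑ j, ‖u (x + latUnit d j) - u x‖ ^ 2) := by
    rw [ENNReal.ofReal_tsum_of_nonneg (fun x => Finset.sum_nonneg fun j _ => by positivity)
      (summable_sum fun j _ => summable_norm_sq_diff hu _)]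
    refine tsum_congr fun x => ?_
    rw [ENNReal.ofReal_sum_of_nonneg fun j _ => by positivity]
    refine Finset.sum_congr rfl fun j _ => ?_
    rw [ENNReal.ofReal_pow (norm_nonneg _), ofReal_norm, enorm_eq_nnnorm]
  have hS : ∑' x : Fin d → ℤ, ((‖u x‖₊ : ℝ≥0∞)) ^ 2 / ENNReal.ofReal (znorm x ^ 2 + 1)
      = ENNReal.ofReal (∑' x, ‖u x‖ ^ 2 * (1 / (znorm x ^ 2 + 1))) := by
    rw [ENNReal.ofReal_tsum_of_nonneg (fun x => by positivity) (summable_norm_sq_mul hu _)]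
    refine tsum_congr fun x => ?_
    rw [mul_one_div, ENNReal.ofReal_div_of_pos (by positivity), ENNReal.ofReal_pow (norm_nonneg _),
      ofReal_norm, enorm_eq_nnnorm]
  rw [hQ, hS, ← ENNReal.ofReal_mul (by positivity)]
  refine ENNReal.ofReal_le_ofReal ?_
  have hle : 1 / (160 * (d : ℝ) ^ 2) * ∑' x, ‖u x‖ ^ 2 * (1 / (znorm x ^ 2 + 1))
      ≤ ∑' x, ‖u x‖ ^ 2 * (1 / (4 * regSq x)) := by
    rw [← tsum_mul_left]
    refine Summable.tsum_le_tsum (fun x => ?_) ((summable_norm_sq_mul hu _).mul_left _)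
      (summable_norm_sq_mul hu _)
    rw [mul_left_comm]
    refine mul_le_mul_of_nonneg_left ?_ (by positivity)
    have hx : 0 ≤ ∑ i, (x i : ℝ) ^ 2 := by positivity
    rw [znorm, Real.sq_sqrt hx, regSq, one_div_mul_one_div]
    refine one_div_le_one_div_of_le (by positivity) ?_
    nlinarith [mul_le_mul_of_nonneg_right (by nlinarith : (1 : ℝ) ≤ d ^ 2) hx]
  have h := hle.trans (tsum_norm_sq_div_regSq_le hd hu)
  have e : 1 / (960 * (d : ℝ) ^ 3) = 1 / (6 * d) * (1 / (160 * (d : ℝ) ^ 2)) := by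
    field_simp
    norm_num
  rw [e, mul_assoc, one_div_mul_eq_div, div_le_iff₀ (by positivity)]
  linarith
end
end

section
/- (Discrete Rozenblum–Lieb–Cwikel estimate.) Let d ≥ 3. There exists a constant C = C(d) such that for every V : ℤ^d → [0,∞) and every s > 0, any finite-dimensional subspace L of the space F of finitely supported functions ℤ^d → ℂ with b_V[u] > s·Q_0[u] for all nonzero u ∈ L satisfies dim L ≤ C · s^{−d/2} · Σ_{x∈ℤ^d} V(x)^{d/2}. Equivalently, n(s,V) ≤ C s^{−d/2} Σ_x V(x)^{d/2}, i.e. N₋(H_{αV}) ≤ C α^{d/2} Σ_x V(x)^{d/2} for all α > 0. -/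
open scoped ENNReal NNReal Topology
open Filter MeasureTheory

noncomputable section

section

open UnitAddTorus

/-- The Haar probability measure on the torus. -/
abbrev torusMeasure (d : ℕ) : Measure (UnitAddTorus (Fin d)) :=
  Measure.pi fun _ => AddCircle.haarAddCircle

/-- Parseval identity on the torus. -/
theorem torus_parseval {d : ℕ} {f : UnitAddTorus (Fin d) → ℂ} (hf : MemLp f 2 (torusMeasure d)) :
    HasSum (fun x : Fin d → ℤ => ‖∫ ξ, mFourier (-x) ξ * f ξ ∂(torusMeasure d)‖ ^ 2)
      (∫ ξ, ‖f ξ‖ ^ 2 ∂(torusMeasure d)) := by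
  have h := @hasSum_sq_mFourierCoeff (Fin d) _ (hf.toLp f)
  have e1 : ∀ x : Fin d → ℤ, mFourierCoeff (hf.toLp f) x =
      ∫ ξ, mFourier (-x) ξ * f ξ ∂(torusMeasure d) := fun x =>
    integral_congr_ae (hf.coeFn_toLp.mono fun ξ h => by simp [h])
  have e2 := integral_congr_ae (hf.coeFn_toLp.mono fun ξ h => (by simp [h] :
    ‖hf.toLp f ξ‖ ^ 2 = ‖f ξ‖ ^ 2))
  simp only [e1] at h
  rw [← e2]
  exact h

theorem integral_mFourier_neg_mul_mFourier {d : ℕ} (x y : Fin d → ℤ) :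
    ∫ ξ, mFourier (-x) ξ * mFourier y ξ ∂(torusMeasure d) = if x = y then 1 else 0 := by
  have h := orthonormal_iff_ite.1 (orthonormal_mFourier (d := Fin d)) x y
  rw [ContinuousMap.inner_toLp] at h
  rw [← h]
  simp only [mFourier_neg, mul_comm]
  rfl

/-- The Fourier symbol of the lattice Laplacian. -/
def latticeSymbol (d : ℕ) (ξ : UnitAddTorus (Fin d)) : ℝ :=
  ∑ j : Fin d, ‖mFourier (-latUnit d j) ξ - 1‖ ^ 2

theorem latticeSymbol_nonneg {d : ℕ} (ξ : UnitAddTorus (Fin d)) : 0 ≤ latticeSymbol d ξ :=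
  Finset.sum_nonneg fun _ _ => sq_nonneg _

theorem continuous_latticeSymbol (d : ℕ) : Continuous (latticeSymbol d) := by
  unfold latticeSymbol
  fun_prop

theorem four_mul_norm_le_norm_fourier_one_sub_one (t : UnitAddCircle) :
    4 * ‖t‖ ≤ ‖(fourier 1 t : ℂ) - 1‖ := by
  induction t using QuotientAddGroup.induction_on with
  | H x =>
    have hx : ((x - round x : ℝ) : UnitAddCircle) = (x : UnitAddCircle) := by
      have : ((round x : ℝ) : UnitAddCircle) = 0 := by
        rw [AddCircle.coe_eq_zero_iff]
        exact ⟨round x, by simp⟩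
      rw [AddCircle.coe_sub, this, sub_zero]
    have hr := abs_sub_round x
    change 4 * ‖(x : UnitAddCircle)‖ ≤ ‖fourier 1 (x : UnitAddCircle) - 1‖
    rw [UnitAddCircle.norm_eq, ← hx]
    set y := x - round x
    rw [fourier_coe_apply]
    have e : (2 * Real.pi * Complex.I * (1 : ℤ) * (y : ℂ) / (1 : ℝ) : ℂ)
        = Complex.I * ((2 * Real.pi * y : ℝ) : ℂ) := by
      push_cast; ring
    rw [e, Complex.norm_exp_I_mul_ofReal_sub_one, norm_mul, Real.norm_eq_abs, Real.norm_eq_abs]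
    have h2 : |2 * Real.pi * y / 2| = Real.pi * |y| := by
      rw [show 2 * Real.pi * y / 2 = Real.pi * y by ring, abs_mul, abs_of_pos Real.pi_pos]
    have h := Real.mul_abs_le_abs_sin (x := 2 * Real.pi * y / 2) (by
      rw [h2]; nlinarith [Real.pi_pos])
    rw [h2, ← mul_assoc, div_mul_cancel₀ _ Real.pi_ne_zero] at h
    rw [abs_of_pos (by norm_num : (0 : ℝ) < 2)]
    linarith

theorem norm_apply_le_of_latticeSymbol_le {d : ℕ} {ξ : UnitAddTorus (Fin d)} {t : ℝ}
    (h : latticeSymbol d ξ ≤ t) (j : Fin d) : ‖ξ j‖ ≤ √t / 2 := by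
  have h1 : mFourier (latUnit d j) ξ = fourier 1 (ξ j) := by
    rw [← mFourier_single]
    congr 2
    ext i
    simp [latUnit, Pi.single_apply]
  have h2 : ‖mFourier (-latUnit d j) ξ - 1‖ = ‖(fourier 1 (ξ j) : ℂ) - 1‖ := by
    rw [mFourier_neg, h1, ← RCLike.norm_conj]
    simp
  have h3 : ‖mFourier (-latUnit d j) ξ - 1‖ ^ 2 ≤ t :=
    (Finset.single_le_sum (f := fun j => ‖mFourier (-latUnit d j) ξ - 1‖ ^ 2)
      (fun _ _ => sq_nonneg _) (Finset.mem_univ j)).trans h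
  have h4 := four_mul_norm_le_norm_fourier_one_sub_one (ξ j)
  have h5 := Real.le_sqrt_of_sq_le h3
  rw [h2] at h5
  linarith [norm_nonneg (ξ j)]

theorem torusMeasure_latticeSymbol_le {d : ℕ} {t : ℝ} (ht : 0 ≤ t) :
    torusMeasure d {ξ | latticeSymbol d ξ ≤ t} ≤ ENNReal.ofReal (t ^ ((d : ℝ) / 2)) := by
  have hsub : {ξ | latticeSymbol d ξ ≤ t} ⊆
      Set.univ.pi fun _ => Metric.closedBall (0 : UnitAddCircle) (√t / 2) := by
    intro ξ hξ j _
    simpa using norm_apply_le_of_latticeSymbol_le hξ j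
  have hvol : AddCircle.haarAddCircle (Metric.closedBall (0 : UnitAddCircle) (√t / 2))
      ≤ ENNReal.ofReal (√t) := by
    have h := AddCircle.volume_closedBall (T := 1) (x := 0) (√t / 2)
    rw [AddCircle.volume_eq_smul_haarAddCircle] at h
    simp only [ENNReal.ofReal_one, one_smul] at h
    rw [h]
    exact ENNReal.ofReal_le_ofReal ((min_le_right _ _).trans (by linarith))
  calc _ ≤ _ := measure_mono hsub
    _ = ∏ _j : Fin d, AddCircle.haarAddCircle (Metric.closedBall (0 : UnitAddCircle) (√t / 2)) :=
      Measure.pi_pi _ _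
    _ ≤ ∏ _j : Fin d, ENNReal.ofReal (√t) := Finset.prod_le_prod' fun _ _ => hvol
    _ = _ := by
      rw [Finset.prod_const, Finset.card_univ, Fintype.card_fin,
        ← ENNReal.ofReal_pow (Real.sqrt_nonneg t), Real.sqrt_eq_rpow, ← Real.rpow_natCast,
        ← Real.rpow_mul ht]
      congr 2
      ring

theorem ae_latticeSymbol_pos {d : ℕ} (hd : 0 < d) :
    ∀ᵐ ξ ∂(torusMeasure d), 0 < latticeSymbol d ξ := by
  have h := torusMeasure_latticeSymbol_le (d := d) le_rfl
  rw [Real.zero_rpow (by positivity), ENNReal.ofReal_zero, nonpos_iff_eq_zero] at h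
  simpa [ae_iff] using h

theorem lintegral_inv_latticeSymbol_le {d : ℕ} (hd : 3 ≤ d) {E : ℝ} (hE : 0 < E) :
    ∫⁻ ξ in {ξ | latticeSymbol d ξ ≤ E}, ENNReal.ofReal (latticeSymbol d ξ)⁻¹ ∂(torusMeasure d)
      ≤ ENNReal.ofReal (8 * E ^ ((d : ℝ) / 2 - 1)) := by
  have hm : ∀ t, MeasurableSet {ξ | latticeSymbol d ξ ≤ t} := fun t =>
    measurableSet_le (continuous_latticeSymbol d).measurable measurable_const
  have hpt : ∀ ξ ∈ {ξ | latticeSymbol d ξ ≤ E}, ENNReal.ofReal (latticeSymbol d ξ)⁻¹ ≤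
      ∑' k : ℕ, {ξ | latticeSymbol d ξ ≤ E * (1 / 4) ^ k}.indicator
        (fun _ => ENNReal.ofReal (4 ^ (k + 1) / E)) ξ := by
    intro ξ hξ
    rcases (latticeSymbol_nonneg ξ).eq_or_lt with h0 | h0
    · simp [← h0]
    · obtain ⟨k, hk1, hk2⟩ := exists_nat_pow_near_of_lt_one (x := latticeSymbol d ξ / E)
        (div_pos h0 hE) ((div_le_one hE).2 hξ) (by norm_num : (0 : ℝ) < 1 / 4) (by norm_num)
      refine le_trans ?_ (ENNReal.le_tsum k)
      rw [Set.indicator_of_mem]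
      · refine ENNReal.ofReal_le_ofReal ?_
        rw [lt_div_iff₀ hE, one_div, inv_pow] at hk1
        rw [← inv_div]
        refine inv_anti₀ (by positivity) ?_
        rw [div_eq_inv_mul]
        exact hk1.le
      · rw [div_le_iff₀ hE] at hk2
        simpa [mul_comm] using hk2
  calc _ ≤ _ := setLIntegral_mono' (hm E) hpt
    _ ≤ _ := setLIntegral_le_lintegral _ _
    _ = ∑' k : ℕ, ENNReal.ofReal (4 ^ (k + 1) / E) *
        torusMeasure d {ξ | latticeSymbol d ξ ≤ E * (1 / 4) ^ k} := by
      rw [lintegral_tsum fun k => (measurable_const.indicator (hm _)).aemeasurable]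
      simp_rw [lintegral_indicator_const (hm _)]
    _ ≤ ∑' k : ℕ, ENNReal.ofReal (4 * E ^ ((d : ℝ) / 2 - 1) * (1 / 2) ^ k) := by
      refine ENNReal.tsum_le_tsum fun k => ?_
      refine (mul_le_mul_right (torusMeasure_latticeSymbol_le (by positivity)) _).trans ?_
      rw [← ENNReal.ofReal_mul (by positivity)]
      refine ENNReal.ofReal_le_ofReal ?_
      have h1 : ((1 / 4 : ℝ) ^ k) ^ ((d : ℝ) / 2) ≤ (1 / 8) ^ k := by
        have : ((1 / 4 : ℝ) ^ k) ^ ((d : ℝ) / 2) = ((1 / 2 : ℝ) ^ k) ^ d := by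
          rw [show (1 / 4 : ℝ) = (1 / 2) ^ 2 by norm_num, ← pow_mul, mul_comm 2 k, pow_mul,
            ← Real.rpow_natCast (((1 / 2 : ℝ)) ^ k) 2, ← Real.rpow_mul (by positivity),
            ← Real.rpow_natCast _ d]
          congr 1
          push_cast
          ring
        rw [this, show (1 / 8 : ℝ) = (1 / 2) ^ 3 by norm_num, ← pow_mul (1 / 2 : ℝ) 3 k,
          mul_comm 3 k, pow_mul]
        exact pow_le_pow_of_le_one (by positivity) (pow_le_one₀ (by norm_num) (by norm_num)) hd
      rw [Real.mul_rpow hE.le (by positivity), Real.rpow_sub_one hE.ne']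
      have h2 : (4 : ℝ) ^ (k + 1) * (1 / 8) ^ k = 4 * (1 / 2) ^ k := by
        rw [pow_succ, mul_right_comm, ← mul_pow]
        norm_num [mul_comm]
      have h3 : 0 ≤ E ^ ((d : ℝ) / 2) / E := by positivity
      calc _ = (E ^ ((d : ℝ) / 2) / E) * (4 ^ (k + 1) * ((1 / 4 : ℝ) ^ k) ^ ((d : ℝ) / 2)) := by
            ring
        _ ≤ (E ^ ((d : ℝ) / 2) / E) * (4 ^ (k + 1) * (1 / 8) ^ k) := by gcongr
        _ = _ := by rw [h2]; ring
    _ = _ := by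
      rw [← ENNReal.ofReal_tsum_of_nonneg (fun k => by positivity)
        (summable_geometric_two.mul_left _), tsum_mul_left, tsum_geometric_two]
      congr 1
      ring

/-- The trigonometric polynomial `Σ_{x ∈ X} u x e_x`. -/
def trigPoly {d : ℕ} (X : Finset (Fin d → ℤ)) :
    ((Fin d → ℤ) → ℂ) →ₗ[ℂ] C(UnitAddTorus (Fin d), ℂ) :=
  ∑ x ∈ X, (LinearMap.proj x).smulRight (mFourier x)

theorem trigPoly_apply {d : ℕ} (X : Finset (Fin d → ℤ)) (u : (Fin d → ℤ) → ℂ)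
    (ξ : UnitAddTorus (Fin d)) : trigPoly X u ξ = ∑ x ∈ X, u x * mFourier x ξ := by
  simp [trigPoly, LinearMap.sum_apply, ContinuousMap.sum_apply]

theorem integrable_continuousMap {d : ℕ} {E : Type*} [NormedAddCommGroup E]
    (f : C(UnitAddTorus (Fin d), E)) : Integrable f (torusMeasure d) :=
  f.continuous.integrable_of_hasCompactSupport (HasCompactSupport.of_compactSpace _)

theorem integral_trigPoly {d : ℕ} {X : Finset (Fin d → ℤ)} {u : (Fin d → ℤ) → ℂ}
    (hu : Function.support u ⊆ X) (x : Fin d → ℤ) :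
    ∫ ξ, mFourier (-x) ξ * trigPoly X u ξ ∂(torusMeasure d) = u x := by
  classical
  have h : ∀ ξ, mFourier (-x) ξ * trigPoly X u ξ =
      ∑ y ∈ X, u y * (mFourier (-x) ξ * mFourier y ξ) := fun ξ => by
    rw [trigPoly_apply, Finset.mul_sum]
    exact Finset.sum_congr rfl fun _ _ => by ring
  simp_rw [h]
  have hi : ∀ y ∈ X, Integrable (fun ξ => u y * (mFourier (-x) ξ * mFourier y ξ))
      (torusMeasure d) := fun y _ =>
    (integrable_continuousMap (mFourier (-x) * mFourier y)).const_mul (u y)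
  rw [integral_finsetSum _ hi]
  simp_rw [integral_const_mul, integral_mFourier_neg_mul_mFourier]
  by_cases hx : x ∈ X
  · simp [hx]
  · simp only [mul_ite, mul_one, mul_zero, Finset.sum_ite_eq, hx, if_false]
    by_contra h0
    exact hx (hu (Ne.symm h0))

theorem Q0_eq_integral {d : ℕ} {X : Finset (Fin d → ℤ)} {u : (Fin d → ℤ) → ℂ}
    (hu : Function.support u ⊆ X) :
    Q0 u = ENNReal.ofReal
      (∫ ξ, latticeSymbol d ξ * ‖trigPoly X u ξ‖ ^ 2 ∂(torusMeasure d)) := by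
  have hj : ∀ j : Fin d, HasSum (fun x => ‖u (x + latUnit d j) - u x‖ ^ 2)
      (∫ ξ, ‖mFourier (-latUnit d j) ξ - 1‖ ^ 2 * ‖trigPoly X u ξ‖ ^ 2 ∂(torusMeasure d)) := by
    intro j
    have hc := ContinuousMap.memLp (p := 2) (torusMeasure d) ℂ
      ((mFourier (-latUnit d j) - 1) * trigPoly X u)
    have h := torus_parseval hc
    convert h using 3 with x
    · simp only [ContinuousMap.mul_apply, ContinuousMap.sub_apply, ContinuousMap.one_apply]
      have e : ∀ ξ, mFourier (-x) ξ * ((mFourier (-latUnit d j) ξ - 1) * trigPoly X u ξ) =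
          mFourier (-(x + latUnit d j)) ξ * trigPoly X u ξ - mFourier (-x) ξ * trigPoly X u ξ := by
        intro ξ
        rw [neg_add, mFourier_add]
        ring
      simp_rw [e]
      have hi : ∀ y, Integrable (fun ξ => mFourier (-y) ξ * trigPoly X u ξ) (torusMeasure d) :=
        fun y => integrable_continuousMap (mFourier (-y) * trigPoly X u)
      rw [integral_sub (hi _) (hi _), integral_trigPoly hu, integral_trigPoly hu]
    · simp [mul_pow]
  have hs := hasSum_sum (s := Finset.univ) fun j _ => hj j
  rw [← integral_finsetSum _ fun j _ => ?_] at hs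
  · simp_rw [← Finset.sum_mul] at hs
    change HasSum _ (∫ ξ, latticeSymbol d ξ * ‖trigPoly X u ξ‖ ^ 2 ∂(torusMeasure d)) at hs
    rw [← hs.tsum_eq, ENNReal.ofReal_tsum_of_nonneg
      (fun x => Finset.sum_nonneg fun _ _ => sq_nonneg _) hs.summable]
    refine tsum_congr fun x => ?_
    rw [ENNReal.ofReal_sum_of_nonneg fun _ _ => sq_nonneg _]
    refine Finset.sum_congr rfl fun j _ => ?_
    rw [ENNReal.ofReal_pow (norm_nonneg _), ofReal_norm]
    rfl
  · exact integrable_continuousMap ⟨fun ξ => ‖mFourier (-latUnit d j) ξ - 1‖ ^ 2 *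
      ‖trigPoly X u ξ‖ ^ 2, by fun_prop⟩

theorem bV_eq_sum {d : ℕ} {X : Finset (Fin d → ℤ)} {u : (Fin d → ℤ) → ℂ}
    (hu : Function.support u ⊆ X) {V : (Fin d → ℤ) → ℝ} (hV : ∀ x, 0 ≤ V x) :
    bV V u = ENNReal.ofReal (∑ x ∈ X, V x * ‖u x‖ ^ 2) := by
  rw [bV, tsum_eq_sum (s := X), ENNReal.ofReal_sum_of_nonneg fun x _ =>
    mul_nonneg (hV x) (sq_nonneg _)]
  · refine Finset.sum_congr rfl fun x _ => ?_
    rw [ENNReal.ofReal_mul (hV x), ENNReal.ofReal_pow (norm_nonneg _), ofReal_norm]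
    rfl
  · intro x hx
    have : u x = 0 := by
      by_contra h
      exact hx (hu h)
    simp [this]

theorem sum_two_zpow_le_of_forall_lt {K : Finset ℤ} {t : ℝ} (ht : 0 ≤ t)
    (hK : ∀ k ∈ K, (2 : ℝ) ^ k < t) : ∑ k ∈ K, (2 : ℝ) ^ k ≤ 2 * t := by
  have key : ∀ (K : Finset ℤ) (m : ℤ), (∀ k ∈ K, k ≤ m) → ∑ k ∈ K, (2 : ℝ) ^ k ≤ 2 * 2 ^ m := by
    intro K
    induction K using Finset.induction_on_max with
    | empty =>
      intro m _
      simp only [Finset.sum_empty]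
      positivity
    | insert a K ha ih =>
      intro m hm
      rw [Finset.sum_insert fun h => (ha a h).false]
      have h1 := ih (a - 1) fun k hk => by linarith [Int.add_one_le_of_lt (ha k hk)]
      rw [zpow_sub_one₀ two_ne_zero] at h1
      have h2 : (2 : ℝ) ^ a ≤ 2 ^ m :=
        zpow_le_zpow_right₀ one_le_two (hm a (Finset.mem_insert_self _ _))
      linarith
  rcases K.eq_empty_or_nonempty with rfl | hne
  · simpa using ht
  · have h1 := key K (K.max' hne) fun k hk => K.le_max' k hk
    have h2 := hK _ (K.max'_mem hne)
    linarith

theorem sum_zpow_mul_highFrequency_le {d : ℕ} (f : C(UnitAddTorus (Fin d), ℂ))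
    (X : Finset (Fin d → ℤ)) (k : (Fin d → ℤ) → ℤ) :
    ∑ x ∈ X, (2 : ℝ) ^ k x *
        ‖∫ ξ, mFourier (-x) ξ * {ξ | (2 : ℝ) ^ k x < latticeSymbol d ξ}.indicator f ξ
          ∂(torusMeasure d)‖ ^ 2
      ≤ 2 * ∫ ξ, latticeSymbol d ξ * ‖f ξ‖ ^ 2 ∂(torusMeasure d) := by
  classical
  have hm : ∀ t, MeasurableSet {ξ | t < latticeSymbol d ξ} := fun t =>
    measurableSet_lt measurable_const (continuous_latticeSymbol d).measurable
  have h_int : Integrable (fun ξ => ‖f ξ‖ ^ 2) (torusMeasure d) :=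
    integrable_continuousMap ⟨fun ξ => ‖f ξ‖ ^ 2, by fun_prop⟩
  have h_int' : Integrable (fun ξ => latticeSymbol d ξ * ‖f ξ‖ ^ 2) (torusMeasure d) :=
    integrable_continuousMap ⟨fun ξ => latticeSymbol d ξ * ‖f ξ‖ ^ 2,
      (continuous_latticeSymbol d).mul (by fun_prop)⟩
  have hb : ∀ t : ℝ, ∀ Y : Finset (Fin d → ℤ),
      ∑ x ∈ Y, ‖∫ ξ, mFourier (-x) ξ * {ξ | t < latticeSymbol d ξ}.indicator f ξ
          ∂(torusMeasure d)‖ ^ 2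
        ≤ ∫ ξ, {ξ | t < latticeSymbol d ξ}.indicator (fun ξ => ‖f ξ‖ ^ 2) ξ
          ∂(torusMeasure d) := by
    intro t Y
    have h := torus_parseval
      ((ContinuousMap.memLp (p := 2) (torusMeasure d) ℂ f).indicator (hm t))
    refine (sum_le_hasSum Y (fun _ _ => sq_nonneg _) h).trans_eq ?_
    refine integral_congr_ae (ae_of_all _ fun ξ => ?_)
    by_cases hξ : ξ ∈ {ξ | t < latticeSymbol d ξ} <;> simp [Set.indicator, hξ]
  rw [← Finset.sum_fiberwise_of_maps_to (t := X.image k) fun x hx =>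
    Finset.mem_image_of_mem k hx]
  calc _ ≤ ∑ n ∈ X.image k, (2 : ℝ) ^ n *
        ∫ ξ, {ξ | (2 : ℝ) ^ n < latticeSymbol d ξ}.indicator (fun ξ => ‖f ξ‖ ^ 2) ξ
          ∂(torusMeasure d) := by
        refine Finset.sum_le_sum fun n _ => ?_
        refine le_trans (le_of_eq ?_)
          (mul_le_mul_of_nonneg_left (hb ((2 : ℝ) ^ n) (X.filter fun x => k x = n))
            (by positivity))
        rw [Finset.mul_sum]
        refine Finset.sum_congr rfl fun x hx => ?_
        rw [(Finset.mem_filter.1 hx).2]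
    _ = ∫ ξ, ∑ n ∈ X.image k, (2 : ℝ) ^ n *
        {ξ | (2 : ℝ) ^ n < latticeSymbol d ξ}.indicator (fun ξ => ‖f ξ‖ ^ 2) ξ
          ∂(torusMeasure d) := by
        rw [integral_finsetSum _ fun n _ => (h_int.indicator (hm _)).const_mul _]
        simp_rw [integral_const_mul]
    _ ≤ ∫ ξ, 2 * (latticeSymbol d ξ * ‖f ξ‖ ^ 2) ∂(torusMeasure d) := by
        refine integral_mono (integrable_finsetSum _ fun n _ =>
          (h_int.indicator (hm _)).const_mul _) (h_int'.const_mul 2) fun ξ => ?_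
        have h := sum_two_zpow_le_of_forall_lt (latticeSymbol_nonneg ξ)
          (K := (X.image k).filter fun n => (2 : ℝ) ^ n < latticeSymbol d ξ)
          fun n hn => (Finset.mem_filter.1 hn).2
        rw [Finset.sum_filter] at h
        calc _ = (∑ n ∈ X.image k, if (2 : ℝ) ^ n < latticeSymbol d ξ then (2 : ℝ) ^ n else 0) *
              ‖f ξ‖ ^ 2 := by
              rw [Finset.sum_mul]
              refine Finset.sum_congr rfl fun n _ => ?_
              simp [Set.indicator_apply]
          _ ≤ (2 * latticeSymbol d ξ) * ‖f ξ‖ ^ 2 := by gcongr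
          _ = _ := by ring
    _ = _ := integral_const_mul _ _

/-- The square root of the lattice symbol. -/
def sqrtSymbol (d : ℕ) : C(UnitAddTorus (Fin d), ℂ) :=
  ⟨fun ξ => (√(latticeSymbol d ξ) : ℂ),
    Complex.continuous_ofReal.comp (continuous_latticeSymbol d).sqrt⟩

theorem sqrtSymbol_apply {d : ℕ} (ξ : UnitAddTorus (Fin d)) :
    sqrtSymbol d ξ = (√(latticeSymbol d ξ) : ℂ) := rfl

theorem sum_lowFrequency_le {d : ℕ} (hd : 3 ≤ d) {ι : Type*} [Fintype ι]
    {f : ι → C(UnitAddTorus (Fin d), ℂ)}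
    (hf : Orthonormal ℂ fun i =>
      ContinuousMap.toLp 2 (torusMeasure d) ℂ (sqrtSymbol d * f i))
    {E : ℝ} (hE : 0 < E) (x : Fin d → ℤ) :
    ∑ i, ‖∫ ξ, mFourier (-x) ξ * {ξ | latticeSymbol d ξ ≤ E}.indicator (f i) ξ
        ∂(torusMeasure d)‖ ^ 2 ≤ 8 * E ^ ((d : ℝ) / 2 - 1) := by
  have hm : MeasurableSet {ξ | latticeSymbol d ξ ≤ E} :=
    measurableSet_le (continuous_latticeSymbol d).measurable measurable_const
  set g : UnitAddTorus (Fin d) → ℂ := {ξ | latticeSymbol d ξ ≤ E}.indicator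
    fun ξ => (sqrtSymbol d ξ)⁻¹ * mFourier x ξ with hg
  have hgm : AEStronglyMeasurable g (torusMeasure d) := by
    refine (Measurable.indicator ?_ hm).aestronglyMeasurable
    exact (sqrtSymbol d).continuous.measurable.inv.mul (mFourier x).continuous.measurable
  have hgn : ∀ ξ, ‖g ξ‖ₑ ^ (2 : ℝ) = {ξ | latticeSymbol d ξ ≤ E}.indicator
      (fun ξ => ENNReal.ofReal (latticeSymbol d ξ)⁻¹) ξ := by
    intro ξ
    by_cases hξ : ξ ∈ {ξ | latticeSymbol d ξ ≤ E}
    · rw [hg, Set.indicator_of_mem hξ, Set.indicator_of_mem hξ, ← ofReal_norm,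
        ENNReal.ofReal_rpow_of_nonneg (norm_nonneg _) zero_le_two]
      have h1 : ‖mFourier x ξ‖ = 1 := by
        simp only [mFourier, fourier_apply, ContinuousMap.coe_mk, norm_prod, Circle.norm_coe,
          Finset.prod_const_one]
      rw [norm_mul, h1, norm_inv, sqrtSymbol_apply, Complex.norm_real,
        Real.norm_of_nonneg (Real.sqrt_nonneg _), mul_one, Real.rpow_two, inv_pow,
        Real.sq_sqrt (latticeSymbol_nonneg ξ)]
    · rw [hg, Set.indicator_of_notMem hξ, Set.indicator_of_notMem hξ]
      simp
  have hgl : ∫⁻ ξ, ‖g ξ‖ₑ ^ (2 : ℝ) ∂(torusMeasure d) ≤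
      ENNReal.ofReal (8 * E ^ ((d : ℝ) / 2 - 1)) := by
    simp_rw [hgn]
    rw [lintegral_indicator hm]
    exact lintegral_inv_latticeSymbol_le hd hE
  have hgL : MemLp g 2 (torusMeasure d) := by
    refine ⟨hgm, ?_⟩
    rw [eLpNorm_lt_top_iff_lintegral_rpow_enorm_lt_top two_ne_zero ENNReal.ofNat_ne_top]
    exact hgl.trans_lt ENNReal.ofReal_lt_top
  have hnorm : ‖hgL.toLp g‖ ^ 2 ≤ 8 * E ^ ((d : ℝ) / 2 - 1) := by
    rw [Lp.norm_toLp, ← ENNReal.toReal_pow,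
      eLpNorm_eq_lintegral_rpow_enorm_toReal two_ne_zero ENNReal.ofNat_ne_top,
      ← ENNReal.rpow_natCast, ← ENNReal.rpow_mul]
    norm_num
    exact ENNReal.toReal_le_of_le_ofReal (by positivity) (by simpa using hgl)
  refine le_trans (le_of_eq ?_) ((hf.sum_inner_products_le (s := Finset.univ) (hgL.toLp g)).trans
    hnorm)
  refine Finset.sum_congr rfl fun i _ => ?_
  rw [norm_inner_symm, L2.inner_def]
  congr 2
  refine integral_congr_ae ?_
  filter_upwards [hgL.coeFn_toLp, ContinuousMap.coeFn_toLp (p := 2) (𝕜 := ℂ) (torusMeasure d)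
    (sqrtSymbol d * f i), ae_latticeSymbol_pos (d := d) (by omega)] with ξ h1 h2 h3
  rw [h1, h2, RCLike.inner_apply, hg]
  by_cases hξ : ξ ∈ {ξ | latticeSymbol d ξ ≤ E}
  · have h4 : (√(latticeSymbol d ξ) : ℂ) ≠ 0 := by
      exact_mod_cast (Real.sqrt_pos.2 h3).ne'
    rw [Set.indicator_of_mem hξ, Set.indicator_of_mem hξ, mFourier_neg, ContinuousMap.mul_apply,
      map_mul, sqrtSymbol_apply, map_inv₀, Complex.conj_ofReal]
    field_simp
  · rw [Set.indicator_of_notMem hξ, Set.indicator_of_notMem hξ]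
    simp

theorem inner_toLp_sqrtSymbol_mul_self {d : ℕ} (f : C(UnitAddTorus (Fin d), ℂ)) :
    inner ℂ (ContinuousMap.toLp 2 (torusMeasure d) ℂ (sqrtSymbol d * f))
      (ContinuousMap.toLp 2 (torusMeasure d) ℂ (sqrtSymbol d * f)) =
    ((∫ ξ, latticeSymbol d ξ * ‖f ξ‖ ^ 2 ∂(torusMeasure d) : ℝ) : ℂ) := by
  rw [ContinuousMap.inner_toLp, ← integral_complex_ofReal]
  refine integral_congr_ae (ae_of_all _ fun ξ => ?_)
  simp only [RCLike.mul_conj, ContinuousMap.mul_apply, norm_mul, sqrtSymbol_apply,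
    Complex.norm_real, Real.norm_of_nonneg (Real.sqrt_nonneg _)]
  have h : (√(latticeSymbol d ξ) * ‖f ξ‖) ^ 2 = latticeSymbol d ξ * ‖f ξ‖ ^ 2 := by
    rw [mul_pow, Real.sq_sqrt (latticeSymbol_nonneg ξ)]
  rw [← h]
  exact (Complex.ofReal_pow _ _).symm

theorem eq_zero_of_toLp_sqrtSymbol_mul_eq_zero {d : ℕ} (hd : 0 < d) {X : Finset (Fin d → ℤ)}
    {u : (Fin d → ℤ) → ℂ} (hu : Function.support u ⊆ X)
    (h : ContinuousMap.toLp 2 (torusMeasure d) ℂ (sqrtSymbol d * trigPoly X u) = 0) :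
    u = 0 := by
  have h1 := ContinuousMap.coeFn_toLp (p := 2) (𝕜 := ℂ) (torusMeasure d)
    (sqrtSymbol d * trigPoly X u)
  rw [h] at h1
  ext x
  rw [← integral_trigPoly hu x]
  refine integral_eq_zero_of_ae ?_
  filter_upwards [h1, Lp.coeFn_zero ℂ 2 (torusMeasure d), ae_latticeSymbol_pos hd] with ξ h2 h3 h4
  rw [h3, Pi.zero_apply, ContinuousMap.mul_apply, sqrtSymbol_apply] at h2
  have h5 : (√(latticeSymbol d ξ) : ℂ) ≠ 0 := by
    exact_mod_cast (Real.sqrt_pos.2 h4).ne'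
  simp [(mul_eq_zero.1 h2.symm).resolve_left h5]

theorem sum_mul_density_le {d : ℕ} (hd : 3 ≤ d) {ι : Type*} [Fintype ι]
    {X : Finset (Fin d → ℤ)} {u : ι → (Fin d → ℤ) → ℂ} (hu : ∀ i, Function.support (u i) ⊆ X)
    (ho : Orthonormal ℂ fun i =>
      ContinuousMap.toLp 2 (torusMeasure d) ℂ (sqrtSymbol d * trigPoly X (u i)))
    {V : (Fin d → ℤ) → ℝ} (hV : ∀ x, 0 ≤ V x) {A : ℝ} (hA : 0 < A) :
    ∑ i, ∑ x ∈ X, V x * ‖u i x‖ ^ 2 ≤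
      8 / A * Fintype.card ι +
        16 * A ^ ((d : ℝ) / 2 - 1) * ∑ x ∈ X, V x ^ ((d : ℝ) / 2) := by
  classical
  have hk : ∀ x, ∃ k : ℤ, 0 < V x → (2 : ℝ) ^ k ≤ A * V x ∧ A * V x < 2 * 2 ^ k := by
    intro x
    rcases (hV x).eq_or_lt with h | h
    · exact ⟨0, fun h' => absurd h h'.ne⟩
    · obtain ⟨k, hk1, hk2⟩ := exists_mem_Ico_zpow (mul_pos hA h) (one_lt_two : (1 : ℝ) < 2)
      refine ⟨k, fun _ => ⟨hk1, ?_⟩⟩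
      rwa [zpow_add_one₀ two_ne_zero, mul_comm _ (2 : ℝ)] at hk2
  choose k hk using hk
  set hi : ι → (Fin d → ℤ) → ℂ := fun i x => ∫ ξ, mFourier (-x) ξ *
    {ξ | (2 : ℝ) ^ k x < latticeSymbol d ξ}.indicator (trigPoly X (u i)) ξ ∂(torusMeasure d)
    with hhi
  set lo : ι → (Fin d → ℤ) → ℂ := fun i x => ∫ ξ, mFourier (-x) ξ *
    {ξ | latticeSymbol d ξ ≤ (2 : ℝ) ^ k x}.indicator (trigPoly X (u i)) ξ ∂(torusMeasure d)
    with hlo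
  have hsplit : ∀ i x, u i x = hi i x + lo i x := by
    intro i x
    have hc := (continuous_latticeSymbol d).measurable
    have h_int : ∀ S : Set (UnitAddTorus (Fin d)), MeasurableSet S → Integrable (fun ξ =>
        mFourier (-x) ξ * S.indicator (trigPoly X (u i)) ξ) (torusMeasure d) := by
      intro S hS
      have := (integrable_continuousMap (mFourier (-x) * trigPoly X (u i))).indicator hS
      refine this.congr (ae_of_all _ fun ξ => ?_)
      by_cases hξ : ξ ∈ S <;> simp [hξ]
    rw [hhi, hlo]
    dsimp only
    rw [← integral_add (h_int _ (measurableSet_lt measurable_const hc))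
      (h_int _ (measurableSet_le hc measurable_const)), ← integral_trigPoly (hu i) x]
    refine integral_congr_ae (ae_of_all _ fun ξ => ?_)
    by_cases hξ : (2 : ℝ) ^ k x < latticeSymbol d ξ
    · simp [Set.indicator, hξ, not_le.2 hξ]
    · simp [Set.indicator, hξ, not_lt.1 hξ]
  have hone : ∀ i, ∫ ξ, latticeSymbol d ξ * ‖trigPoly X (u i) ξ‖ ^ 2 ∂(torusMeasure d) = 1 := by
    intro i
    have h := inner_toLp_sqrtSymbol_mul_self (trigPoly X (u i))
    rw [inner_self_eq_norm_sq_to_K, ho.1 i] at h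
    have h' : ((1 : ℝ) : ℂ) = _ := (by simp : ((1 : ℝ) : ℂ) = _).trans h
    exact (Complex.ofReal_injective h').symm
  have hhigh : ∀ i, ∑ x ∈ X, (2 : ℝ) ^ k x * ‖hi i x‖ ^ 2 ≤ 2 := fun i => by
    have h := sum_zpow_mul_highFrequency_le (trigPoly X (u i)) X k
    rwa [hone, mul_one] at h
  have hlow : ∀ x, ∑ i, ‖lo i x‖ ^ 2 ≤ 8 * ((2 : ℝ) ^ k x) ^ ((d : ℝ) / 2 - 1) := fun x =>
    sum_lowFrequency_le hd ho (by positivity) x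
  have hd' : 0 ≤ (d : ℝ) / 2 - 1 := by
    have : (3 : ℝ) ≤ d := by exact_mod_cast hd
    linarith
  have h1 : ∀ i, ∀ x ∈ X, V x * ‖u i x‖ ^ 2 ≤
      4 / A * (2 ^ k x * ‖hi i x‖ ^ 2) + 2 * (V x * ‖lo i x‖ ^ 2) := by
    intro i x _
    have h2 : ‖u i x‖ ^ 2 ≤ 2 * ‖hi i x‖ ^ 2 + 2 * ‖lo i x‖ ^ 2 := by
      have := norm_add_le (hi i x) (lo i x)
      rw [hsplit]
      nlinarith [sq_nonneg (‖hi i x‖ - ‖lo i x‖), norm_nonneg (hi i x + lo i x)]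
    have h3 : V x ≤ 2 / A * 2 ^ k x := by
      rcases (hV x).eq_or_lt with h | h
      · rw [← h]
        positivity
      · have := (hk x h).2
        rw [div_mul_eq_mul_div, le_div_iff₀ hA]
        linarith
    calc V x * ‖u i x‖ ^ 2 ≤ V x * (2 * ‖hi i x‖ ^ 2 + 2 * ‖lo i x‖ ^ 2) :=
          mul_le_mul_of_nonneg_left h2 (hV x)
      _ = 2 * (V x * ‖hi i x‖ ^ 2) + 2 * (V x * ‖lo i x‖ ^ 2) := by ring
      _ ≤ 2 * (2 / A * 2 ^ k x * ‖hi i x‖ ^ 2) + 2 * (V x * ‖lo i x‖ ^ 2) := by gcongr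
      _ = _ := by ring
  have h4 : ∀ x ∈ X, V x * ∑ i, ‖lo i x‖ ^ 2 ≤
      8 * A ^ ((d : ℝ) / 2 - 1) * V x ^ ((d : ℝ) / 2) := by
    intro x _
    rcases (hV x).eq_or_lt with h | h
    · rw [← h, zero_mul]
      positivity
    · calc V x * ∑ i, ‖lo i x‖ ^ 2 ≤ V x * (8 * ((2 : ℝ) ^ k x) ^ ((d : ℝ) / 2 - 1)) :=
            mul_le_mul_of_nonneg_left (hlow x) (hV x)
        _ ≤ V x * (8 * (A * V x) ^ ((d : ℝ) / 2 - 1)) := by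
            have := (hk x h).1
            gcongr
        _ = _ := by
            rw [Real.mul_rpow hA.le h.le, Real.rpow_sub_one h.ne']
            field_simp
  calc _ ≤ ∑ i, ∑ x ∈ X, (4 / A * (2 ^ k x * ‖hi i x‖ ^ 2) + 2 * (V x * ‖lo i x‖ ^ 2)) :=
        Finset.sum_le_sum fun i _ => Finset.sum_le_sum (h1 i)
    _ = 4 / A * ∑ i, ∑ x ∈ X, (2 : ℝ) ^ k x * ‖hi i x‖ ^ 2 +
          2 * ∑ x ∈ X, V x * ∑ i, ‖lo i x‖ ^ 2 := by
        simp_rw [Finset.sum_add_distrib, Finset.mul_sum]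
        congr 1
        exact Finset.sum_comm
    _ ≤ 4 / A * ∑ _i : ι, 2 +
          2 * ∑ x ∈ X, 8 * A ^ ((d : ℝ) / 2 - 1) * V x ^ ((d : ℝ) / 2) := by
        have h5 := Finset.sum_le_sum fun i (_ : i ∈ Finset.univ) => hhigh i
        have h6 := Finset.sum_le_sum h4
        gcongr
    _ = _ := by
        rw [← Finset.mul_sum, Finset.sum_const, Finset.card_univ, nsmul_eq_mul]
        ring

theorem exists_finset_support_subset {α : Type*} (L : Submodule ℂ (α → ℂ))
    (hL : ∀ u ∈ L, (Function.support u).Finite) [FiniteDimensional ℂ L] :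
    ∃ X : Finset α, ∀ u ∈ L, Function.support u ⊆ X := by
  classical
  let b := Module.finBasis ℂ L
  refine ⟨Finset.univ.biUnion fun i => (hL (b i) (b i).2).toFinset, fun u hu x hx => ?_⟩
  by_contra hxX
  simp only [Finset.coe_biUnion, Set.mem_iUnion, not_exists, Finset.mem_coe, Finset.mem_univ,
    Set.Finite.coe_toFinset, Function.mem_support, not_not, forall_true_left] at hxX
  have h := congrArg (fun v : L => (v : α → ℂ) x) (b.sum_repr ⟨u, hu⟩)
  simp only [Submodule.coe_sum, Submodule.coe_smul, Finset.sum_apply, Pi.smul_apply, hxX,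
    smul_zero, Finset.sum_const_zero] at h
  exact hx h.symm

end

/-- the discrete Rozenblum–Lieb–Cwikel estimate
`n(s,V) ≤ C s^{−d/2} Σ_x V(x)^{d/2}`, in subspace form. -/
theorem discrete_CLR (d : ℕ) (hd : 3 ≤ d) :
    ∃ C : ℝ, 0 < C ∧
      ∀ V : (Fin d → ℤ) → ℝ, (∀ x, 0 ≤ V x) →
      ∀ s : ℝ, 0 < s →
      ∀ L : Submodule ℂ ((Fin d → ℤ) → ℂ),
        (∀ u ∈ L, (Function.support u).Finite) →
        FiniteDimensional ℂ L →
        (∀ u ∈ L, u ≠ 0 → ENNReal.ofReal s * Q0 u < bV V u) →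
        ENNReal.ofReal (s ^ ((d : ℝ) / 2)) * (Module.finrank ℂ L : ℝ≥0∞) ≤
          ENNReal.ofReal C * ∑' x : Fin d → ℤ, ENNReal.ofReal (V x ^ ((d : ℝ) / 2)) := by
  refine ⟨2 * 16 ^ ((d : ℝ) / 2), by positivity, fun V hV s hs L hL _ hLV => ?_⟩
  obtain ⟨X, hX⟩ := exists_finset_support_subset L hL
  let T : L →ₗ[ℂ] Lp ℂ 2 (torusMeasure d) :=
    (ContinuousMap.toLp 2 (torusMeasure d) ℂ).toLinearMap ∘ₗ
      LinearMap.mulLeft ℂ (sqrtSymbol d) ∘ₗ trigPoly X ∘ₗ L.subtype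
  have hT : ∀ u : L, T u =
      ContinuousMap.toLp 2 (torusMeasure d) ℂ (sqrtSymbol d * trigPoly X u) := fun _ => rfl
  have hinj : Function.Injective T := (injective_iff_map_eq_zero T).2 fun u hu =>
    Subtype.ext <| eq_zero_of_toLp_sqrtSymbol_mul_eq_zero (by omega) (hX u u.2)
      ((hT u).symm.trans hu)
  have hrank : Module.finrank ℂ (LinearMap.range T) = Module.finrank ℂ L :=
    LinearMap.finrank_range_of_inj hinj
  let b := stdOrthonormalBasis ℂ (LinearMap.range T)
  choose u hu using fun i => (b i).2
  have ho : Orthonormal ℂ fun i =>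
      ContinuousMap.toLp 2 (torusMeasure d) ℂ (sqrtSymbol d * trigPoly X (u i)) := by
    have h := b.orthonormal.comp_linearIsometry (LinearMap.range T).subtypeₗᵢ
    convert h using 2 with i
    exact (hT _).symm.trans (hu i)
  have hsum := sum_mul_density_le hd (fun i => hX (u i) (u i).2) ho hV (A := 16 / s)
    (by positivity)
  have hlow : ∀ i, s ≤ ∑ x ∈ X, V x * ‖(u i : (Fin d → ℤ) → ℂ) x‖ ^ 2 := by
    intro i
    have hne : (u i : (Fin d → ℤ) → ℂ) ≠ 0 := by
      intro h0
      refine ho.ne_zero i ?_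
      rw [h0, map_zero, mul_zero, map_zero]
    have h := hLV _ (u i).2 hne
    have hone := inner_toLp_sqrtSymbol_mul_self (trigPoly X (u i))
    rw [inner_self_eq_norm_sq_to_K, ho.1 i] at hone
    have hone' : ((1 : ℝ) : ℂ) = _ := (by simp : ((1 : ℝ) : ℂ) = _).trans hone
    rw [Q0_eq_integral (hX _ (u i).2), ← Complex.ofReal_injective hone', ENNReal.ofReal_one,
      mul_one, bV_eq_sum (hX _ (u i).2) hV] at h
    exact ((ENNReal.ofReal_lt_ofReal_iff_of_nonneg hs.le).1 h).le
  have hN := (Finset.card_nsmul_le_sum Finset.univ _ s fun i _ => hlow i).trans hsum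
  rw [Finset.card_univ, Fintype.card_fin, hrank, nsmul_eq_mul] at hN
  have hreal : s ^ ((d : ℝ) / 2) * Module.finrank ℂ L ≤
      2 * 16 ^ ((d : ℝ) / 2) * ∑ x ∈ X, V x ^ ((d : ℝ) / 2) := by
    rw [Real.rpow_sub_one (by positivity), Real.div_rpow (by norm_num) hs.le] at hN
    have hp : 0 < s ^ ((d : ℝ) / 2) := by positivity
    field_simp at hN
    field_simp
    linarith
  calc _ = ENNReal.ofReal (s ^ ((d : ℝ) / 2) * Module.finrank ℂ L) := by
        rw [ENNReal.ofReal_mul (by positivity), ENNReal.ofReal_natCast]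
    _ ≤ _ := ENNReal.ofReal_le_ofReal hreal
    _ = ENNReal.ofReal (2 * 16 ^ ((d : ℝ) / 2)) *
          ∑ x ∈ X, ENNReal.ofReal (V x ^ ((d : ℝ) / 2)) := by
        rw [ENNReal.ofReal_mul (by positivity),
          ENNReal.ofReal_sum_of_nonneg fun x _ => Real.rpow_nonneg (hV x) _]
    _ ≤ _ := by
        gcongr
        exact ENNReal.sum_le_tsum X
end
end

section
/- Let d ≥ 3 and let V : ℤ^d → [0,∞) satisfy Σ_{x∈ℤ^d} V(x)^{d/2} < ∞. Then s^{d/2} · n(s,V) → 0 as s → 0⁺; that is, for every ε > 0 there is s₀ > 0 such that for all 0 < s < s₀, every finite-dimensional subspace L of F with b_V[u] > s·Q_0[u] for all nonzero u ∈ L has dim L ≤ ε · s^{−d/2}. Equivalently, N₋(H_{αV}) = o(α^{d/2}) as α → ∞. -/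
open scoped ENNReal NNReal Topology
open Filter MeasureTheory

noncomputable section

open scoped ComplexConjugate

theorem sum_norm_sq_integral_conj_mul_le {Ω κ : Type*} [DecidableEq κ] [MeasurableSpace Ω]
    {μ : Measure Ω}
    {f : κ → Ω → ℂ} (hf : ∀ i, MemLp (f i) 2 μ)
    (ho : ∀ i j, ∫ t, conj (f i t) * f j t ∂μ = if i = j then 1 else 0)
    {g : Ω → ℂ} (hg : MemLp g 2 μ) (s : Finset κ) :
    ∑ i ∈ s, ‖∫ t, conj (f i t) * g t ∂μ‖ ^ 2 ≤ ∫ t, ‖g t‖ ^ 2 ∂μ := by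
  have inner_eq : ∀ {a b : Ω → ℂ} (ha : MemLp a 2 μ) (hb : MemLp b 2 μ),
      inner ℂ (ha.toLp a) (hb.toLp b) = ∫ t, conj (a t) * b t ∂μ := by
    intro a b ha hb
    rw [L2.inner_def]
    refine integral_congr_ae ?_
    filter_upwards [ha.coeFn_toLp, hb.coeFn_toLp] with t h1 h2
    rw [h1, h2, RCLike.inner_apply, mul_comm]
  have hv : Orthonormal ℂ (fun i => (hf i).toLp (f i)) := by
    rw [orthonormal_iff_ite]
    intro i j
    rw [inner_eq, ho]
  have := hv.sum_inner_products_le (hg.toLp g) (s := s)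
  simp only [inner_eq] at this
  refine this.trans (le_of_eq ?_)
  have h3 : ((‖hg.toLp g‖ ^ 2 : ℝ) : ℂ) = ((∫ t, ‖g t‖ ^ 2 ∂μ : ℝ) : ℂ) := by
    have := inner_self_eq_norm_sq_to_K (𝕜 := ℂ) (hg.toLp g)
    rw [inner_eq] at this
    push_cast
    rw [← integral_complex_ofReal]
    refine this.symm.trans (integral_congr_ae (.of_forall fun t => ?_))
    simp only [Complex.conj_mul']
    push_cast
    rfl
  exact_mod_cast h3

theorem exists_orthonormal_lift {Ω : Type*} [MeasurableSpace Ω] {μ : Measure Ω}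
    {E : Type*} [AddCommGroup E] [Module ℂ E] [FiniteDimensional ℂ E]
    (T : E →ₗ[ℂ] (Ω → ℂ)) (hT : ∀ u, MemLp (T u) 2 μ)
    (hinj : ∀ u, T u =ᵐ[μ] 0 → u = 0) :
    ∃ u : Fin (Module.finrank ℂ E) → E,
      ∀ i j, ∫ t, conj (T (u i) t) * T (u j) t ∂μ = if i = j then 1 else 0 := by
  let S : E →ₗ[ℂ] Lp ℂ 2 μ :=
    { toFun := fun u => (hT u).toLp (T u)
      map_add' := fun u v => by
        rw [← MemLp.toLp_add]
        exact MemLp.toLp_congr _ _ (by simp)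
      map_smul' := fun c u => by
        rw [RingHom.id_apply, ← MemLp.toLp_const_smul]
        exact MemLp.toLp_congr _ _ (by simp) }
  have hS : Function.Injective S := by
    rw [← LinearMap.ker_eq_bot, LinearMap.ker_eq_bot']
    intro u hu
    exact hinj u ((MemLp.toLp_eq_toLp_iff (hT u) MemLp.zero).1 (by rw [MemLp.toLp_zero]; exact hu))
  let b := stdOrthonormalBasis ℂ (LinearMap.range S)
  have hr : Module.finrank ℂ (LinearMap.range S) = Module.finrank ℂ E :=
    LinearMap.finrank_range_of_inj hS
  let b' := b.reindex (finCongr hr)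
  choose u hu using fun i => (b' i).2
  refine ⟨u, fun i j => ?_⟩
  have h1 := orthonormal_iff_ite.1 b'.orthonormal i j
  rw [← h1, Submodule.coe_inner, ← hu, ← hu, L2.inner_def]
  refine integral_congr_ae ?_
  filter_upwards [(hT (u i)).coeFn_toLp, (hT (u j)).coeFn_toLp] with t h1 h2
  simp only [S, LinearMap.coe_mk, AddHom.coe_mk]
  rw [h1, h2, RCLike.inner_apply, mul_comm]

theorem sum_zpow_two_le {K : Finset ℤ} {a : ℝ} (ha : 0 ≤ a) (h : ∀ k ∈ K, (2 : ℝ) ^ k ≤ a) :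
    ∑ k ∈ K, (2 : ℝ) ^ k ≤ 2 * a := by
  have key : ∀ K : Finset ℤ, ∀ m : ℤ, (∀ k ∈ K, k ≤ m) → ∑ k ∈ K, (2 : ℝ) ^ k ≤ 2 ^ (m + 1) := by
    intro K
    induction K using Finset.induction_on_max with
    | empty => intro m _; simp; positivity
    | insert a s hs ih =>
      intro m hm
      rw [Finset.sum_insert (fun h => lt_irrefl _ (hs a h))]
      have h1 := ih (a - 1) (fun k hk => by have := hs k hk; omega)
      have h2 : (2 : ℝ) ^ (a + 1) ≤ 2 ^ (m + 1) :=
        zpow_le_zpow_right₀ (by norm_num) (by have := hm a (Finset.mem_insert_self _ _); omega)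
      rw [sub_add_cancel] at h1
      rw [zpow_add_one₀ two_ne_zero] at h2
      linarith
  rcases K.eq_empty_or_nonempty with rfl | hK
  · simpa using ha
  · have h1 := key K (K.max' hK) (fun k hk => K.le_max' k hk)
    have h2 := h _ (K.max'_mem hK)
    rw [zpow_add_one₀ two_ne_zero] at h1
    linarith

/-- A bounded measurable orthonormal system of functions on a measure space. -/
structure IsBoundedOrthonormal {Ω ι : Type*} [DecidableEq ι] [MeasurableSpace Ω] (μ : Measure Ω)
    (e : ι → Ω → ℂ) : Prop where
  measurable : ∀ x, Measurable (e x)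
  norm_le : ∀ x t, ‖e x t‖ ≤ 1
  ortho : ∀ x y, ∫ t, conj (e x t) * e y t ∂μ = if x = y then 1 else 0

/-- The finite linear combination `∑ x ∈ X, u x • e x`, linear in the coefficients. -/
def finSynth {Ω ι : Type*} (e : ι → Ω → ℂ) (X : Finset ι) : (ι → ℂ) →ₗ[ℂ] (Ω → ℂ) where
  toFun u t := ∑ x ∈ X, u x * e x t
  map_add' u v := by ext t; simp [add_mul, Finset.sum_add_distrib]
  map_smul' c u := by ext t; simp [mul_assoc, Finset.mul_sum]

theorem finSynth_apply {Ω ι : Type*} (e : ι → Ω → ℂ) (X : Finset ι) (u : ι → ℂ) (t : Ω) :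
    finSynth e X u t = ∑ x ∈ X, u x * e x t := rfl

theorem integrable_of_measurable_norm_le {Ω E : Type*} [MeasurableSpace Ω] {μ : Measure Ω}
    [IsFiniteMeasure μ] [NormedAddCommGroup E] [MeasurableSpace E] [BorelSpace E]
    [SecondCountableTopology E] {f : Ω → E} (hf : Measurable f) {C : ℝ}
    (h : ∀ t, ‖f t‖ ≤ C) : Integrable f μ :=
  Integrable.of_bound hf.aestronglyMeasurable C (.of_forall h)

namespace IsBoundedOrthonormal

variable {Ω ι : Type*} [DecidableEq ι] [MeasurableSpace Ω] {μ : Measure Ω} {e : ι → Ω → ℂ}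

theorem measurable_finSynth (he : IsBoundedOrthonormal μ e) (X : Finset ι) (u : ι → ℂ) :
    Measurable (finSynth e X u) := by
  have := he.measurable
  change Measurable fun t => ∑ x ∈ X, u x * e x t
  fun_prop

theorem norm_finSynth_le (he : IsBoundedOrthonormal μ e) (X : Finset ι) (u : ι → ℂ) (t : Ω) :
    ‖finSynth e X u t‖ ≤ ∑ x ∈ X, ‖u x‖ := by
  rw [finSynth_apply]
  refine (norm_sum_le _ _).trans (Finset.sum_le_sum fun x _ => ?_)
  rw [norm_mul]
  exact mul_le_of_le_one_right (norm_nonneg _) (he.norm_le x t)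

theorem integrable_conj_mul [IsFiniteMeasure μ] (he : IsBoundedOrthonormal μ e) (x : ι)
    {g : Ω → ℂ} (hg : Measurable g) {C : ℝ} (hC : ∀ t, ‖g t‖ ≤ C) :
    Integrable (fun t => conj (e x t) * g t) μ := by
  have := he.measurable x
  refine integrable_of_measurable_norm_le (C := C) (by fun_prop) fun t => ?_
  rw [norm_mul, RCLike.norm_conj]
  exact (mul_le_of_le_one_left (norm_nonneg _) (he.norm_le x t)).trans (hC t)

theorem integral_conj_mul_finSynth [IsFiniteMeasure μ] (he : IsBoundedOrthonormal μ e)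
    {X : Finset ι} (u : ι → ℂ) {x : ι} (hx : x ∈ X) :
    ∫ t, conj (e x t) * finSynth e X u t ∂μ = u x := by
  simp only [finSynth_apply, Finset.mul_sum]
  rw [integral_finsetSum]
  · simp only [mul_left_comm _ (u _), integral_const_mul, he.ortho]
    simp [hx]
  · intro y _
    simp only [mul_left_comm _ (u _)]
    exact (he.integrable_conj_mul x (he.measurable y) (he.norm_le y)).const_mul _

theorem integral_norm_sq_finSynth [IsFiniteMeasure μ] (he : IsBoundedOrthonormal μ e)
    (X : Finset ι) (u : ι → ℂ) :
    ∫ t, ‖finSynth e X u t‖ ^ 2 ∂μ = ∑ x ∈ X, ‖u x‖ ^ 2 := by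
  have h : ((∫ t, ‖finSynth e X u t‖ ^ 2 ∂μ : ℝ) : ℂ) = ((∑ x ∈ X, ‖u x‖ ^ 2 : ℝ) : ℂ) := by
    rw [← integral_complex_ofReal]
    have : ∀ t, ((‖finSynth e X u t‖ ^ 2 : ℝ) : ℂ) =
        ∑ x ∈ X, conj (u x) * (conj (e x t) * finSynth e X u t) := by
      intro t
      rw [Complex.ofReal_pow, ← Complex.conj_mul']
      conv_lhs => rw [finSynth_apply, map_sum, Finset.sum_mul]
      simp only [finSynth_apply, map_mul, mul_assoc]
    simp only [this]
    rw [integral_finsetSum]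
    · push_cast
      refine Finset.sum_congr rfl fun x hx => ?_
      rw [integral_const_mul, he.integral_conj_mul_finSynth u hx, Complex.conj_mul']
    · intro x _
      exact (he.integrable_conj_mul x (he.measurable_finSynth X u)
        (he.norm_finSynth_le X u)).const_mul _
  exact_mod_cast h

theorem memLp_finSynth [IsFiniteMeasure μ] (he : IsBoundedOrthonormal μ e) (X : Finset ι)
    (u : ι → ℂ) : MemLp (finSynth e X u) 2 μ :=
  MemLp.of_bound (he.measurable_finSynth X u).aestronglyMeasurable _
    (.of_forall (he.norm_finSynth_le X u))

/-- Bessel's inequality for the part of a function living where the symbol is large. -/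
theorem sum_mul_norm_sq_high_le [IsFiniteMeasure μ] (he : IsBoundedOrthonormal μ e)
    {ω : Ω → ℝ} (hω : Measurable ω) (hω0 : ∀ t, 0 ≤ ω t) {B : ℝ} (hωB : ∀ t, ω t ≤ B)
    {F : Ω → ℂ} (hF : Measurable F) {D : ℝ} (hFD : ∀ t, ‖F t‖ ≤ D) {l : ℝ} (hl : 0 < l)
    (X : Finset ι) (k : ι → ℤ) :
    ∑ x ∈ X, (2 : ℝ) ^ k x *
        ‖∫ t, conj (e x t) * {t | l * 2 ^ k x < ω t}.indicator F t ∂μ‖ ^ 2 ≤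
      2 / l * ∫ t, ω t * ‖F t‖ ^ 2 ∂μ := by
  have hset : ∀ m : ℤ, MeasurableSet {t | l * 2 ^ m < ω t} := fun m =>
    measurableSet_lt measurable_const hω
  have hind : ∀ (m : ℤ) t, ‖{t | l * 2 ^ m < ω t}.indicator F t‖ ≤ D := fun m t =>
    (norm_indicator_le_norm_self _ _).trans (hFD t)
  have hei : ∀ x, MemLp (e x) 2 μ := fun x =>
    MemLp.of_bound (he.measurable x).aestronglyMeasurable 1 (.of_forall (he.norm_le x))
  have h_int : ∀ m : ℤ, Integrable (fun t => ‖{t | l * 2 ^ m < ω t}.indicator F t‖ ^ 2) μ := by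
    intro m
    refine integrable_of_measurable_norm_le (C := D ^ 2)
      ((hF.indicator (hset m)).norm.pow_const 2) fun t => ?_
    rw [norm_pow, norm_norm]
    exact pow_le_pow_left₀ (norm_nonneg _) (hind m t) 2
  have h_intω : Integrable (fun t => ω t * ‖F t‖ ^ 2) μ := by
    refine integrable_of_measurable_norm_le (C := B * D ^ 2)
      (hω.mul (hF.norm.pow_const 2)) fun t => ?_
    rw [norm_mul, norm_pow, norm_norm, Real.norm_of_nonneg (hω0 t)]
    have := hFD t
    have := (hω0 t).trans (hωB t)
    gcongr
    exact hωB t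
  rw [← Finset.sum_fiberwise_of_maps_to (g := k) (t := X.image k)
    (fun x hx => Finset.mem_image_of_mem k hx)]
  calc _ ≤ ∑ m ∈ X.image k, (2 : ℝ) ^ m *
        ∫ t, ‖{t | l * 2 ^ m < ω t}.indicator F t‖ ^ 2 ∂μ := by
        refine Finset.sum_le_sum fun m _ => ?_
        have h1 := sum_norm_sq_integral_conj_mul_le hei he.ortho
          (MemLp.of_bound (hF.indicator (hset m)).aestronglyMeasurable D (.of_forall (hind m)))
          (X.filter (k · = m))
        refine le_trans (le_of_eq ?_) (mul_le_mul_of_nonneg_left h1 (by positivity))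
        rw [Finset.mul_sum]
        refine Finset.sum_congr rfl fun x hx => ?_
        rw [(Finset.mem_filter.1 hx).2]
    _ = ∫ t, ∑ m ∈ X.image k, (2 : ℝ) ^ m *
          ‖{t | l * 2 ^ m < ω t}.indicator F t‖ ^ 2 ∂μ := by
        rw [integral_finsetSum _ fun m _ => (h_int m).const_mul _]
        simp only [integral_const_mul]
    _ ≤ ∫ t, 2 / l * (ω t * ‖F t‖ ^ 2) ∂μ := by
        refine integral_mono (integrable_finsetSum _ fun m _ => (h_int m).const_mul _)
          (h_intω.const_mul _) fun t => ?_
        have h2 : ∀ m : ℤ, (2 : ℝ) ^ m * ‖{t | l * 2 ^ m < ω t}.indicator F t‖ ^ 2 =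
            if l * 2 ^ m < ω t then (2 : ℝ) ^ m * ‖F t‖ ^ 2 else 0 := by
          intro m
          by_cases h : l * 2 ^ m < ω t <;> simp [Set.indicator, h]
        simp only [h2]
        rw [← Finset.sum_filter, ← Finset.sum_mul]
        have h3 := sum_zpow_two_le (K := (X.image k).filter fun m => l * 2 ^ m < ω t)
          (a := ω t / l) (div_nonneg (hω0 t) hl.le) fun m hm => by
            rw [le_div_iff₀ hl, mul_comm]
            exact (Finset.mem_filter.1 hm).2.le
        calc _ ≤ 2 * (ω t / l) * ‖F t‖ ^ 2 := by gcongr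
          _ = _ := by ring
    _ = _ := integral_const_mul _ _

/-- Bessel's inequality for the parts of an orthonormal family living where the symbol is small. -/
theorem sum_norm_sq_low_le (he : IsBoundedOrthonormal μ e)
    {ω : Ω → ℝ} (hω : Measurable ω) (hωpos : ∀ᵐ t ∂μ, 0 < ω t)
    {E M : ℝ} (hM : 0 ≤ M)
    (hlow : ∫⁻ t in {t | ω t ≤ E}, (ENNReal.ofReal (ω t))⁻¹ ∂μ ≤ ENNReal.ofReal M)
    {κ : Type*} [Fintype κ] [DecidableEq κ] {F : κ → Ω → ℂ}
    (hF : ∀ i, MemLp (fun t => (Real.sqrt (ω t) : ℂ) * F i t) 2 μ)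
    (ho : ∀ i j, ∫ t, conj ((Real.sqrt (ω t) : ℂ) * F i t) * ((Real.sqrt (ω t) : ℂ) * F j t) ∂μ =
      if i = j then 1 else 0) (x : ι) :
    ∑ i, ‖∫ t, conj (e x t) * {t | ω t ≤ E}.indicator (F i) t ∂μ‖ ^ 2 ≤ M := by
  have hset : MeasurableSet {t | ω t ≤ E} := measurableSet_le hω measurable_const
  set g : Ω → ℂ := {t | ω t ≤ E}.indicator fun t => ((Real.sqrt (ω t))⁻¹ : ℝ) * e x t with hg
  have hgm : Measurable g := by
    have := he.measurable x
    refine Measurable.indicator ?_ hset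
    fun_prop
  have hgle : ∫⁻ t, ‖g t‖ₑ ^ 2 ∂μ ≤ ENNReal.ofReal M := by
    refine le_trans ?_ hlow
    rw [← lintegral_indicator hset]
    refine lintegral_mono_ae ?_
    filter_upwards [hωpos] with t ht
    by_cases h : ω t ≤ E
    · simp only [hg, Set.indicator, Set.mem_ofPred_eq, h, if_true]
      rw [← ENNReal.ofReal_inv_of_pos ht, ← ofReal_norm, ← ENNReal.ofReal_pow (norm_nonneg _)]
      refine ENNReal.ofReal_le_ofReal ?_
      rw [norm_mul, mul_pow, Complex.norm_real, norm_inv, inv_pow, Real.norm_eq_abs, sq_abs,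
        Real.sq_sqrt ht.le]
      exact mul_le_of_le_one_right (inv_nonneg.2 ht.le)
        (pow_le_one₀ (norm_nonneg _) (he.norm_le x t))
    · simp [hg, Set.indicator, h]
  have hgL : MemLp g 2 μ := by
    refine ⟨hgm.aestronglyMeasurable, ?_⟩
    rw [eLpNorm_lt_top_iff_lintegral_rpow_enorm_lt_top two_ne_zero ENNReal.ofNat_ne_top]
    simpa using hgle.trans_lt ENNReal.ofReal_lt_top
  have h1 := sum_norm_sq_integral_conj_mul_le hF ho hgL Finset.univ
  refine le_trans (le_of_eq (Finset.sum_congr rfl fun i _ => ?_)) (h1.trans ?_)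
  · rw [← RCLike.norm_conj, ← integral_conj]
    congr 2
    refine integral_congr_ae ?_
    filter_upwards [hωpos] with t ht
    have : (Real.sqrt (ω t) : ℂ) ≠ 0 := by
      exact_mod_cast (Real.sqrt_pos.2 ht).ne'
    by_cases h : ω t ≤ E
    · simp only [hg, Set.indicator, Set.mem_ofPred_eq, h, if_true, map_mul, Complex.conj_conj,
        Complex.conj_ofReal]
      push_cast
      field_simp
    · simp [hg, Set.indicator, h]
  · rw [integral_eq_lintegral_of_nonneg_ae (.of_forall fun t => by positivity)
      (by fun_prop)]
    refine ENNReal.toReal_le_of_le_ofReal hM (le_trans (le_of_eq ?_) hgle)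
    refine lintegral_congr fun t => ?_
    rw [ENNReal.ofReal_pow (norm_nonneg _), ofReal_norm]

/-- An abstract Cwikel–Lieb–Rozenblum bound, with symbol `ω` in place of the Laplacian. -/
theorem finrank_le_of_symbol_le [IsFiniteMeasure μ] (he : IsBoundedOrthonormal μ e)
    {ω : Ω → ℝ} (hω : Measurable ω) (hω0 : ∀ t, 0 ≤ ω t) {B : ℝ} (hωB : ∀ t, ω t ≤ B)
    (hωpos : ∀ᵐ t ∂μ, 0 < ω t) {C p : ℝ} (hC : 0 ≤ C) (hp : 0 < p)
    (hlow : ∀ E : ℝ, 0 < E → ∫⁻ t in {t | ω t ≤ E}, (ENNReal.ofReal (ω t))⁻¹ ∂μ ≤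
      ENNReal.ofReal (C * E ^ (p - 1)))
    (X : Finset ι) (W : ι → ℝ) (hW : ∀ x, 0 ≤ W x)
    (L : Submodule ℂ (ι → ℂ)) [FiniteDimensional ℂ L] (hLX : ∀ u ∈ L, ∀ x ∉ X, u x = 0)
    (hL : ∀ u ∈ L, u ≠ 0 →
      ∫ t, ω t * ‖finSynth e X u t‖ ^ 2 ∂μ ≤ ∑ x ∈ X, W x * ‖u x‖ ^ 2) :
    (Module.finrank ℂ L : ℝ) ≤ 4 * C * 8 ^ (p - 1) * 2 ^ p * ∑ x ∈ X, W x ^ p := by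
  let S : (Ω → ℂ) →ₗ[ℂ] (Ω → ℂ) :=
    { toFun := fun f t => (Real.sqrt (ω t) : ℂ) * f t
      map_add' := fun f g => by ext t; simp [mul_add]
      map_smul' := fun c f => by ext t; simp [mul_left_comm] }
  have hSn : ∀ f t, ‖S f t‖ ^ 2 = ω t * ‖f t‖ ^ 2 := by
    intro f t
    simp only [S, LinearMap.coe_mk, AddHom.coe_mk]
    rw [norm_mul, mul_pow, Complex.norm_real, Real.norm_eq_abs, sq_abs, Real.sq_sqrt (hω0 t)]
  let T : L →ₗ[ℂ] (Ω → ℂ) := S ∘ₗ finSynth e X ∘ₗ L.subtype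
  have hTL : ∀ u, MemLp (T u) 2 μ := by
    intro u
    have h1 := he.measurable_finSynth X u
    refine MemLp.of_bound (C := Real.sqrt B * ∑ x ∈ X, ‖(u : ι → ℂ) x‖) ?_ (.of_forall fun t => ?_)
    · refine Measurable.aestronglyMeasurable ?_
      change Measurable fun t => (Real.sqrt (ω t) : ℂ) * finSynth e X u t
      fun_prop
    · change ‖(Real.sqrt (ω t) : ℂ) * finSynth e X u t‖ ≤ _
      rw [norm_mul, Complex.norm_real, Real.norm_of_nonneg (Real.sqrt_nonneg _)]
      gcongr
      · exact hωB t
      · exact he.norm_finSynth_le X u t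
  set N := Module.finrank ℂ L with hN
  obtain ⟨u, hu⟩ := exists_orthonormal_lift T hTL fun u hu => by
    have h0 : finSynth e X u =ᵐ[μ] 0 := by
      filter_upwards [hu, hωpos] with t h1 h2
      have h1 : (Real.sqrt (ω t) : ℂ) * finSynth e X u t = 0 := h1
      have : (Real.sqrt (ω t) : ℂ) ≠ 0 := by exact_mod_cast (Real.sqrt_pos.2 h2).ne'
      simpa [this] using h1
    ext x
    by_cases hx : x ∈ X
    · rw [← he.integral_conj_mul_finSynth (u : ι → ℂ) hx]
      refine integral_eq_zero_of_ae ?_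
      filter_upwards [h0] with t ht
      simp [ht]
    · exact hLX u u.2 x hx
  set F : Fin N → Ω → ℂ := fun i => finSynth e X (u i) with hFdef
  have hnorm : ∀ i, ∫ t, ω t * ‖F i t‖ ^ 2 ∂μ = 1 := by
    intro i
    have h1 := hu i i
    simp only [if_true, Complex.conj_mul'] at h1
    have h2 : (∫ t, ‖T (u i) t‖ ^ 2 ∂μ : ℝ) = 1 := by
      have : ((∫ t, ‖T (u i) t‖ ^ 2 ∂μ : ℝ) : ℂ) = ((1 : ℝ) : ℂ) := by
        rw [← integral_complex_ofReal, Complex.ofReal_one, ← h1]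
        push_cast
        rfl
      exact_mod_cast this
    rw [← h2]
    exact integral_congr_ae (.of_forall fun t => (hSn _ t).symm)
  have hune : ∀ i, (u i : ι → ℂ) ≠ 0 := by
    intro i h
    have := hnorm i
    simp [hFdef, h] at this
  have hk : ∀ x, ∃ k : ℤ, 0 < W x → W x ≤ 2 ^ k ∧ (2 : ℝ) ^ k ≤ 2 * W x := by
    intro x
    by_cases h : 0 < W x
    · obtain ⟨n, h1, h2⟩ := exists_mem_Ioc_zpow h (one_lt_two)
      refine ⟨n + 1, fun _ => ⟨h2, ?_⟩⟩
      rw [zpow_add_one₀ two_ne_zero]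
      linarith
    · exact ⟨0, fun h' => absurd h' h⟩
  choose k hk using hk
  set Y := X.filter fun x => 0 < W x
  set hi : Fin N → ι → ℂ := fun i x =>
    ∫ t, conj (e x t) * {t | 8 * 2 ^ k x < ω t}.indicator (F i) t ∂μ with hhi
  set lo : Fin N → ι → ℂ := fun i x =>
    ∫ t, conj (e x t) * {t | ω t ≤ 8 * 2 ^ k x}.indicator (F i) t ∂μ with hlo
  have hFm : ∀ i, Measurable (F i) := fun i => he.measurable_finSynth X _
  have hsplit : ∀ i, ∀ x ∈ X, (u i : ι → ℂ) x = lo i x + hi i x := by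
    intro i x hx
    have h1 : MeasurableSet {t | ω t ≤ 8 * 2 ^ k x} := measurableSet_le hω measurable_const
    have h2 : MeasurableSet {t | 8 * 2 ^ k x < ω t} := measurableSet_lt measurable_const hω
    rw [← he.integral_conj_mul_finSynth (u i : ι → ℂ) hx, hlo, hhi]
    simp only
    have hb : ∀ (s : Set Ω) t, ‖s.indicator (F i) t‖ ≤ _ := fun s t =>
      (norm_indicator_le_norm_self _ _).trans (he.norm_finSynth_le X (u i) t)
    rw [← integral_add (he.integrable_conj_mul x ((hFm i).indicator h1) (hb _))
      (he.integrable_conj_mul x ((hFm i).indicator h2) (hb _))]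
    refine integral_congr_ae (.of_forall fun t => ?_)
    simp only [← mul_add]
    congr 1
    by_cases h : ω t ≤ 8 * 2 ^ k x
    · simp [Set.indicator, h, hFdef]
    · simp [Set.indicator, h, not_le.1 h, hFdef]
  have hone : ∀ i, 1 ≤ 2 * ∑ x ∈ Y, 2 ^ k x * ‖lo i x‖ ^ 2 +
      2 * ∑ x ∈ Y, 2 ^ k x * ‖hi i x‖ ^ 2 := by
    intro i
    have h1 := hL (u i) (u i).2 (hune i)
    rw [hnorm i] at h1
    have h2 : ∑ x ∈ X, W x * ‖(u i : ι → ℂ) x‖ ^ 2 = ∑ x ∈ Y, W x * ‖(u i : ι → ℂ) x‖ ^ 2 := by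
      refine (Finset.sum_filter_of_ne fun x _ h => ?_).symm
      exact (hW x).lt_of_ne fun h0 => h (by rw [← h0, zero_mul])
    rw [h2] at h1
    refine h1.trans ?_
    rw [Finset.mul_sum, Finset.mul_sum, ← Finset.sum_add_distrib]
    refine Finset.sum_le_sum fun x hx => ?_
    obtain ⟨hxX, hxW⟩ := Finset.mem_filter.1 hx
    rw [hsplit i x hxX]
    have h3 : ‖lo i x + hi i x‖ ^ 2 ≤ 2 * ‖lo i x‖ ^ 2 + 2 * ‖hi i x‖ ^ 2 := by
      have := pow_le_pow_left₀ (norm_nonneg _) (norm_add_le (lo i x) (hi i x)) 2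
      nlinarith [sq_nonneg (‖lo i x‖ - ‖hi i x‖)]
    calc _ ≤ 2 ^ k x * (2 * ‖lo i x‖ ^ 2 + 2 * ‖hi i x‖ ^ 2) :=
          mul_le_mul (hk x hxW).1 h3 (by positivity) (by positivity)
      _ = _ := by ring
  have hhigh : ∀ i, ∑ x ∈ Y, (2 : ℝ) ^ k x * ‖hi i x‖ ^ 2 ≤ 1 / 4 := by
    intro i
    have := he.sum_mul_norm_sq_high_le hω hω0 hωB (hFm i) (he.norm_finSynth_le X (u i))
      (l := 8) (by norm_num) Y k
    rw [hnorm i] at this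
    norm_num at this ⊢
    exact this
  have hlow' : ∀ x, ∑ i, ‖lo i x‖ ^ 2 ≤ C * (8 * 2 ^ k x) ^ (p - 1) := fun x =>
    he.sum_norm_sq_low_le hω hωpos (F := F) (by positivity) (hlow (8 * 2 ^ k x) (by positivity))
      (fun i => hTL (u i)) hu x
  have hsum : (N : ℝ) ≤ 2 * ∑ x ∈ Y, 2 ^ k x * (C * (8 * 2 ^ k x) ^ (p - 1)) + N / 2 := by
    calc (N : ℝ) = ∑ i : Fin N, (1 : ℝ) := by simp
      _ ≤ ∑ i : Fin N, (2 * ∑ x ∈ Y, 2 ^ k x * ‖lo i x‖ ^ 2 + 2 * (1 / 4)) :=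
          Finset.sum_le_sum fun i _ => (hone i).trans (by have := hhigh i; linarith)
      _ = 2 * ∑ x ∈ Y, 2 ^ k x * ∑ i, ‖lo i x‖ ^ 2 + N / 2 := by
          rw [Finset.sum_add_distrib, ← Finset.mul_sum, Finset.sum_comm]
          simp only [Finset.mul_sum, Finset.sum_const, Finset.card_univ, Fintype.card_fin,
            nsmul_eq_mul]
          ring
      _ ≤ _ := by
          gcongr with x hx
          exact hlow' x
  have hpow : ∀ x ∈ Y, (2 : ℝ) ^ k x * (C * (8 * 2 ^ k x) ^ (p - 1)) ≤
      C * 8 ^ (p - 1) * 2 ^ p * W x ^ p := by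
    intro x hx
    have hxW := (Finset.mem_filter.1 hx).2
    have h2 : (0 : ℝ) < 2 ^ k x := by positivity
    calc _ = C * 8 ^ (p - 1) * (2 ^ k x : ℝ) ^ p := by
          rw [Real.mul_rpow (by norm_num) h2.le, Real.rpow_sub_one h2.ne']
          field_simp
      _ ≤ C * 8 ^ (p - 1) * (2 * W x) ^ p := by
          gcongr
          exact (hk x hxW).2
      _ = _ := by rw [Real.mul_rpow (by norm_num) hxW.le]; ring
  have hfin := Finset.sum_le_sum hpow
  rw [← Finset.mul_sum] at hfin
  have hYX : ∑ x ∈ Y, W x ^ p ≤ ∑ x ∈ X, W x ^ p :=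
    Finset.sum_le_sum_of_subset_of_nonneg (Finset.filter_subset _ _)
      fun x _ _ => Real.rpow_nonneg (hW x) p
  have := mul_le_mul_of_nonneg_left hYX (show 0 ≤ C * 8 ^ (p - 1) * 2 ^ p by positivity)
  linarith

end IsBoundedOrthonormal

/-- The normalized measure on the cube `(-1/2, 1/2]^d`. -/
def cubeMeasure (d : ℕ) : Measure (Fin d → ℝ) :=
  Measure.pi fun _ => (volume : Measure ℝ).restrict (Set.Ioc (-(1 / 2)) (1 / 2))

instance (d : ℕ) : IsFiniteMeasure (cubeMeasure d) := by
  unfold cubeMeasure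
  infer_instance

/-- The character `ξ ↦ exp(2πi x·ξ)` of the lattice point `x`. -/
def latChar {d : ℕ} (x : Fin d → ℤ) (ξ : Fin d → ℝ) : ℂ :=
  ∏ j, Complex.exp (2 * Real.pi * Complex.I * x j * ξ j)

/-- The symbol of the discrete Laplacian. -/
def latSymbol {d : ℕ} (ξ : Fin d → ℝ) : ℝ :=
  ∑ j, ‖Complex.exp (Complex.I * (-(2 * Real.pi * ξ j) : ℝ)) - 1‖ ^ 2

theorem norm_latChar {d : ℕ} (x : Fin d → ℤ) (ξ : Fin d → ℝ) : ‖latChar x ξ‖ = 1 := by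
  rw [latChar, norm_prod]
  refine Finset.prod_eq_one fun j _ => ?_
  rw [show (2 * Real.pi * Complex.I * x j * ξ j : ℂ) =
    ((2 * Real.pi * x j * ξ j : ℝ) : ℂ) * Complex.I by push_cast; ring]
  exact Complex.norm_exp_ofReal_mul_I _

theorem integral_exp_two_pi_int (n : ℤ) :
    ∫ t in Set.Ioc (-(1 / 2) : ℝ) (1 / 2), Complex.exp (2 * Real.pi * Complex.I * n * t) =
      if n = 0 then 1 else 0 := by
  rw [← intervalIntegral.integral_of_le (by norm_num)]
  split_ifs with h
  · simp [h]; norm_num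
  · have hc : (2 * Real.pi * Complex.I * n : ℂ) ≠ 0 := by
      simp [Real.pi_ne_zero, h]
    rw [integral_exp_mul_complex hc, div_eq_zero_iff]
    left
    rw [sub_eq_zero, Complex.exp_eq_exp_iff_exists_int]
    exact ⟨n, by push_cast; ring⟩

theorem isBoundedOrthonormal_latChar (d : ℕ) :
    IsBoundedOrthonormal (cubeMeasure d) (latChar (d := d)) where
  measurable x := by
    unfold latChar
    fun_prop
  norm_le x t := (norm_latChar x t).le
  ortho x y := by
    have h : ∀ ξ : Fin d → ℝ, conj (latChar x ξ) * latChar y ξ =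
        ∏ j, Complex.exp (2 * Real.pi * Complex.I * (y j - x j : ℤ) * ξ j) := by
      intro ξ
      rw [latChar, latChar, map_prod, ← Finset.prod_mul_distrib]
      refine Finset.prod_congr rfl fun j _ => ?_
      rw [← Complex.exp_conj, ← Complex.exp_add]
      congr 1
      simp only [map_mul, Complex.conj_I, Complex.conj_ofReal, map_ofNat, map_intCast]
      push_cast
      ring
    simp only [h]
    rw [cubeMeasure, integral_fintype_prod_eq_prod
      (f := fun j (t : ℝ) => Complex.exp (2 * Real.pi * Complex.I * (y j - x j : ℤ) * t))]
    simp only [integral_exp_two_pi_int]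
    split_ifs with hxy
    · simp [hxy]
    · obtain ⟨j, hj⟩ := Function.ne_iff.1 hxy
      refine Finset.prod_eq_zero (Finset.mem_univ j) (if_neg ?_)
      rw [sub_eq_zero]
      exact fun h => hj h.symm

theorem measurable_latSymbol (d : ℕ) : Measurable (latSymbol (d := d)) := by
  unfold latSymbol
  fun_prop

theorem latSymbol_nonneg {d : ℕ} (ξ : Fin d → ℝ) : 0 ≤ latSymbol ξ :=
  Finset.sum_nonneg fun _ _ => by positivity

theorem latSymbol_le {d : ℕ} (ξ : Fin d → ℝ) : latSymbol ξ ≤ ∑ _j : Fin d, (2 : ℝ) ^ 2 := by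
  refine Finset.sum_le_sum fun j _ => pow_le_pow_left₀ (norm_nonneg _) ?_ 2
  refine (norm_sub_le _ _).trans ?_
  rw [mul_comm, Complex.norm_exp_ofReal_mul_I, norm_one]
  norm_num

theorem sq_le_latSymbol {d : ℕ} {ξ : Fin d → ℝ} (j : Fin d) (hj : |ξ j| ≤ 1 / 2) :
    ξ j ^ 2 ≤ latSymbol ξ := by
  have h1 : ‖Complex.exp (Complex.I * (-(2 * Real.pi * ξ j) : ℝ)) - 1‖ ^ 2 ≤ latSymbol ξ :=
    Finset.single_le_sum
      (f := fun j => ‖Complex.exp (Complex.I * (-(2 * Real.pi * ξ j) : ℝ)) - 1‖ ^ 2)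
      (fun _ _ => by positivity) (Finset.mem_univ j)
  refine le_trans ?_ h1
  rw [← sq_abs]
  refine pow_le_pow_left₀ (abs_nonneg _) ?_ 2
  rw [Complex.norm_exp_I_mul_ofReal_sub_one, Real.norm_eq_abs, abs_mul, abs_two]
  have h2 := Real.mul_abs_le_abs_sin (x := -(2 * Real.pi * ξ j) / 2) (by
    rw [show -(2 * Real.pi * ξ j) / 2 = -(Real.pi * ξ j) by ring, abs_neg, abs_mul,
      abs_of_pos Real.pi_pos]
    nlinarith [Real.pi_pos])
  rw [show -(2 * Real.pi * ξ j) / 2 = -(Real.pi * ξ j) by ring, abs_neg, abs_mul,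
    abs_of_pos Real.pi_pos, show 2 / Real.pi * (Real.pi * |ξ j|) = 2 * |ξ j| by
      field_simp] at h2
  rw [show -(2 * Real.pi * ξ j) / 2 = -(Real.pi * ξ j) by ring]
  linarith [abs_nonneg (ξ j)]

theorem ae_cubeMeasure (d : ℕ) : ∀ᵐ ξ ∂cubeMeasure d, ∀ j, |ξ j| ≤ 1 / 2 ∧ ξ j ≠ 0 := by
  rw [eventually_all]
  intro j
  have h : ∀ᵐ t ∂(volume : Measure ℝ).restrict (Set.Ioc (-(1 / 2)) (1 / 2)), |t| ≤ 1 / 2 := by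
    filter_upwards [ae_restrict_mem measurableSet_Ioc] with t ht
    exact abs_le.2 ⟨ht.1.le, ht.2⟩
  have h1 : ∀ᵐ ξ ∂cubeMeasure d, |ξ j| ≤ 1 / 2 :=
    (Measure.tendsto_eval_ae_ae (i := j)
      (μ := fun _ : Fin d => (volume : Measure ℝ).restrict _)).eventually h
  have h2 : ∀ᵐ ξ ∂cubeMeasure d, ξ j ≠ 0 :=
    Measure.ae_eval_ne (fun _ : Fin d => (volume : Measure ℝ).restrict _) j 0
  exact h1.and h2

theorem ae_latSymbol_pos {d : ℕ} (hd : 0 < d) : ∀ᵐ ξ ∂cubeMeasure d, 0 < latSymbol ξ := by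
  filter_upwards [ae_cubeMeasure d] with ξ h
  have := h ⟨0, hd⟩
  exact (sq_pos_of_ne_zero this.2).trans_le (sq_le_latSymbol _ this.1)

theorem integral_indicator_abs_rpow {a R : ℝ} (ha : a < 1) (hR : 0 < R) :
    ∫ t : ℝ, (Set.Ioc 0 R).indicator (fun r => r ^ (-a)) |t| = 2 / (1 - a) * R ^ (1 - a) := by
  rw [integral_comp_abs, setIntegral_indicator measurableSet_Ioc, Set.inter_eq_right.2
    Set.Ioc_subset_Ioi_self, ← intervalIntegral.integral_of_le hR.le,
    integral_rpow (Or.inl (by linarith)), Real.zero_rpow (by linarith)]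
  rw [neg_add_eq_sub]
  ring

theorem lintegral_inv_latSymbol_le {d : ℕ} (hd : 3 ≤ d) {E : ℝ} (hE : 0 < E) :
    ∫⁻ ξ in {ξ | latSymbol ξ ≤ E}, (ENNReal.ofReal (latSymbol ξ))⁻¹ ∂cubeMeasure d ≤
      ENNReal.ofReal ((2 / (1 - 2 / d)) ^ d * E ^ ((d : ℝ) / 2 - 1)) := by
  have hd0 : (0 : ℝ) < d := by positivity
  have ha : (2 : ℝ) / d < 1 := by
    rw [div_lt_one hd0]
    exact_mod_cast hd
  have hR : 0 < Real.sqrt E := Real.sqrt_pos.2 hE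
  set h : ℝ → ℝ := fun t =>
    (Set.Ioc 0 (Real.sqrt E)).indicator (fun r => r ^ (-((2 : ℝ) / d))) |t| with hh
  have h_int : ∫ t, h t = 2 / (1 - 2 / d) * Real.sqrt E ^ (1 - (2 : ℝ) / d) :=
    integral_indicator_abs_rpow ha hR
  have h0 : ∀ t, 0 ≤ h t := fun t =>
    Set.indicator_nonneg (fun r hr => Real.rpow_nonneg hr.1.le _) _
  have hi : Integrable h := Integrable.of_integral_ne_zero (by
    rw [h_int]
    have : 0 < 1 - (2 : ℝ) / d := by linarith
    positivity)
  have hprod : Integrable (fun ξ : Fin d → ℝ => ∏ j, h (ξ j)) (cubeMeasure d) :=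
    Integrable.fintype_prod (f := fun _ => h) fun _ => hi.restrict
  have hmeas : MeasurableSet {ξ : Fin d → ℝ | latSymbol ξ ≤ E} :=
    measurableSet_le (measurable_latSymbol d) measurable_const
  calc _ ≤ ∫⁻ ξ, ENNReal.ofReal (∏ j, h (ξ j)) ∂cubeMeasure d := by
        rw [← lintegral_indicator hmeas]
        refine lintegral_mono_ae ?_
        filter_upwards [ae_cubeMeasure d, ae_latSymbol_pos (by omega)] with ξ hξ hpos
        by_cases hE' : latSymbol ξ ≤ E
        · rw [Set.indicator_of_mem (by exact hE'), ← ENNReal.ofReal_inv_of_pos hpos]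
          refine ENNReal.ofReal_le_ofReal ?_
          have h1 : (latSymbol ξ)⁻¹ = ∏ _j : Fin d, latSymbol ξ ^ (-(1 / (d : ℝ))) := by
            rw [Finset.prod_const, Finset.card_univ, Fintype.card_fin, ← Real.rpow_natCast,
              ← Real.rpow_mul hpos.le, neg_mul, one_div_mul_cancel hd0.ne', Real.rpow_neg_one]
          rw [h1]
          refine Finset.prod_le_prod (fun _ _ => Real.rpow_nonneg hpos.le _) fun j _ => ?_
          obtain ⟨h2, h3⟩ := hξ j
          have h4 := sq_le_latSymbol j h2
          have h5 : |ξ j| ∈ Set.Ioc 0 (Real.sqrt E) :=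
            ⟨abs_pos.2 h3, Real.abs_le_sqrt (h4.trans hE')⟩
          simp only [hh]
          rw [Set.indicator_of_mem h5]
          calc _ ≤ (ξ j ^ 2) ^ (-(1 / (d : ℝ))) :=
                Real.rpow_le_rpow_of_nonpos (by positivity) h4 (by
                  rw [neg_nonpos]; positivity)
            _ = _ := by
                rw [← sq_abs, ← Real.rpow_natCast, ← Real.rpow_mul (abs_nonneg _)]
                congr 1
                push_cast
                ring
        · rw [Set.indicator_of_notMem (by exact hE')]
          exact zero_le
    _ = ENNReal.ofReal (∫ ξ, ∏ j, h (ξ j) ∂cubeMeasure d) :=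
        (ofReal_integral_eq_lintegral_ofReal hprod
          (.of_forall fun ξ => Finset.prod_nonneg fun j _ => h0 _)).symm
    _ ≤ _ := by
        refine ENNReal.ofReal_le_ofReal ?_
        rw [cubeMeasure, integral_fintype_prod_eq_pow, Fintype.card_fin]
        calc _ ≤ (2 / (1 - 2 / d) * Real.sqrt E ^ (1 - (2 : ℝ) / d)) ^ d := by
              refine pow_le_pow_left₀ (integral_nonneg h0) ?_ d
              rw [← h_int]
              exact setIntegral_le_integral hi (.of_forall h0)
          _ = _ := by
              rw [mul_pow]
              congr 1
              rw [Real.sqrt_eq_rpow, ← Real.rpow_mul hE.le, ← Real.rpow_natCast,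
                ← Real.rpow_mul hE.le]
              congr 1
              field_simp

theorem latChar_sub_latUnit {d : ℕ} (x : Fin d → ℤ) (j : Fin d) (ξ : Fin d → ℝ) :
    latChar (x - latUnit d j) ξ =
      Complex.exp (Complex.I * (-(2 * Real.pi * ξ j) : ℝ)) * latChar x ξ := by
  have h : Complex.exp (Complex.I * (-(2 * Real.pi * ξ j) : ℝ)) =
      ∏ i, Complex.exp (if i = j then Complex.I * (-(2 * Real.pi * ξ j) : ℝ) else 0) := by
    rw [← Complex.exp_sum, Finset.sum_ite_eq' Finset.univ j
      (fun _ => Complex.I * ((-(2 * Real.pi * ξ j) : ℝ) : ℂ)), if_pos (Finset.mem_univ j)]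
  rw [h, latChar, latChar, ← Finset.prod_mul_distrib]
  refine Finset.prod_congr rfl fun i _ => ?_
  rw [← Complex.exp_add]
  congr 1
  rw [Pi.sub_apply, latUnit]
  split_ifs with hij
  · subst hij
    push_cast
    ring
  · push_cast
    ring

theorem ofReal_integral_latSymbol_le_Q0 {d : ℕ} (X : Finset (Fin d → ℤ))
    {u : (Fin d → ℤ) → ℂ} (hu : ∀ x ∉ X, u x = 0) :
    ENNReal.ofReal (∫ ξ, latSymbol ξ * ‖finSynth latChar X u ξ‖ ^ 2 ∂cubeMeasure d) ≤ Q0 u := by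
  set Y : Finset (Fin d → ℤ) :=
    X ∪ Finset.univ.biUnion fun j => X.image fun x => x - latUnit d j with hY
  have he := isBoundedOrthonormal_latChar d
  have hexp : ∀ (j : Fin d) ξ,
      (Complex.exp (Complex.I * (-(2 * Real.pi * ξ j) : ℝ)) - 1) * finSynth latChar X u ξ =
        finSynth latChar Y (fun y => u (y + latUnit d j) - u y) ξ := by
    intro j ξ
    simp only [finSynth_apply, sub_mul, Finset.sum_sub_distrib, one_mul]
    congr 1
    · rw [Finset.mul_sum]
      have h1 : ∑ x ∈ X, Complex.exp (Complex.I * (-(2 * Real.pi * ξ j) : ℝ)) *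
          (u x * latChar x ξ) = ∑ y ∈ X.image (fun x => x - latUnit d j),
            u (y + latUnit d j) * latChar y ξ := by
        rw [Finset.sum_image fun a _ b _ h => sub_left_injective h]
        refine Finset.sum_congr rfl fun x _ => ?_
        rw [latChar_sub_latUnit, sub_add_cancel]
        ring
      rw [h1]
      refine Finset.sum_subset (fun y hy => Finset.mem_union_right _
        (Finset.mem_biUnion.2 ⟨j, Finset.mem_univ j, hy⟩)) fun y _ hy => ?_
      rw [hu, zero_mul]
      exact fun h => hy (Finset.mem_image.2 ⟨_, h, add_sub_cancel_right _ _⟩)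
    · refine Finset.sum_subset Finset.subset_union_left fun y _ hy => ?_
      rw [hu y hy, zero_mul]
  have h_int : ∫ ξ, latSymbol ξ * ‖finSynth latChar X u ξ‖ ^ 2 ∂cubeMeasure d =
      ∑ y ∈ Y, ∑ j, ‖u (y + latUnit d j) - u y‖ ^ 2 := by
    have h1 : ∀ ξ, latSymbol ξ * ‖finSynth latChar X u ξ‖ ^ 2 =
        ∑ j, ‖finSynth latChar Y (fun y => u (y + latUnit d j) - u y) ξ‖ ^ 2 := by
      intro ξ
      simp only [← hexp, norm_mul, mul_pow]
      rw [← Finset.sum_mul, latSymbol]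
    simp only [h1]
    rw [integral_finsetSum, Finset.sum_comm]
    · simp only [he.integral_norm_sq_finSynth]
    · intro j _
      exact (he.memLp_finSynth Y _).integrable_norm_pow two_ne_zero
  rw [h_int, Q0, ENNReal.ofReal_sum_of_nonneg fun _ _ => by positivity]
  refine le_trans (le_of_eq ?_) (ENNReal.sum_le_tsum Y)
  refine Finset.sum_congr rfl fun y _ => ?_
  rw [ENNReal.ofReal_sum_of_nonneg fun _ _ => by positivity]
  refine Finset.sum_congr rfl fun j _ => ?_
  rw [ENNReal.ofReal_pow (norm_nonneg _), ofReal_norm]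
  rfl

/-- The Cwikel–Lieb–Rozenblum bound on the lattice. -/
theorem exists_finrank_le_sum_rpow {d : ℕ} (hd : 3 ≤ d) : ∃ K : ℝ, 0 < K ∧
    ∀ (X : Finset (Fin d → ℤ)) (W : (Fin d → ℤ) → ℝ), (∀ x, 0 ≤ W x) →
    ∀ (L : Submodule ℂ ((Fin d → ℤ) → ℂ)) [FiniteDimensional ℂ L],
      (∀ u ∈ L, ∀ x ∉ X, u x = 0) →
      (∀ u ∈ L, u ≠ 0 → Q0 u ≤ ENNReal.ofReal (∑ x ∈ X, W x * ‖u x‖ ^ 2)) →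
      (Module.finrank ℂ L : ℝ) ≤ K * ∑ x ∈ X, W x ^ ((d : ℝ) / 2) := by
  have hd0 : (0 : ℝ) < d := by positivity
  have ha : (2 : ℝ) / d < 1 := by
    rw [div_lt_one hd0]
    exact_mod_cast hd
  have ha' : 0 < 1 - (2 : ℝ) / d := by linarith
  refine ⟨4 * (2 / (1 - 2 / d)) ^ d * 8 ^ ((d : ℝ) / 2 - 1) * 2 ^ ((d : ℝ) / 2), by positivity,
    fun X W hW L _ hLX hL => ?_⟩
  refine (isBoundedOrthonormal_latChar d).finrank_le_of_symbol_le (measurable_latSymbol d)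
    latSymbol_nonneg latSymbol_le (ae_latSymbol_pos (by omega)) (by positivity) (by positivity)
    (fun E hE => lintegral_inv_latSymbol_le hd hE) X W hW L hLX fun u hu hu0 => ?_
  have h1 := (ofReal_integral_latSymbol_le_Q0 X (hLX u hu)).trans (hL u hu hu0)
  exact (ENNReal.ofReal_le_ofReal_iff
    (Finset.sum_nonneg fun x _ => mul_nonneg (hW x) (by positivity))).1 h1

theorem bV_eq_ofReal_sum {d : ℕ} {V : (Fin d → ℤ) → ℝ} (hV : ∀ x, 0 ≤ V x)
    {X : Finset (Fin d → ℤ)} {u : (Fin d → ℤ) → ℂ} (hu : ∀ x ∉ X, u x = 0) :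
    bV V u = ENNReal.ofReal (∑ x ∈ X, V x * ‖u x‖ ^ 2) := by
  rw [bV, tsum_eq_sum (s := X) fun x hx => by simp [hu x hx],
    ENNReal.ofReal_sum_of_nonneg fun x _ => mul_nonneg (hV x) (by positivity)]
  refine Finset.sum_congr rfl fun x _ => ?_
  rw [ENNReal.ofReal_mul (hV x), ENNReal.ofReal_pow (norm_nonneg _), ofReal_norm]
  rfl

theorem exists_finset_support {ι : Type*} (L : Submodule ℂ (ι → ℂ)) [FiniteDimensional ℂ L]
    (hL : ∀ u ∈ L, (Function.support u).Finite) :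
    ∃ X : Finset ι, ∀ u ∈ L, ∀ x ∉ X, u x = 0 := by
  classical
  let b := Module.finBasis ℂ L
  refine ⟨Finset.univ.biUnion fun i => (hL (b i) (b i).2).toFinset, fun u hu x hx => ?_⟩
  have h1 := congrArg (fun v : L => (v : ι → ℂ) x) (b.sum_repr ⟨u, hu⟩)
  simp only at h1
  rw [← h1, Submodule.coe_sum, Finset.sum_apply]
  refine Finset.sum_eq_zero fun i _ => ?_
  simp only [Finset.mem_biUnion, Finset.mem_univ, Set.Finite.mem_toFinset, Function.mem_support,
    true_and, not_exists, not_not] at hx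
  simp [hx i]

/-- Passing to the functions vanishing on a finite set `A` costs at most `#A` dimensions. -/
theorem exists_le_vanishing_finrank {ι : Type*} (L : Submodule ℂ (ι → ℂ)) [FiniteDimensional ℂ L]
    (A : Finset ι) : ∃ L' ≤ L, (∀ u ∈ L', ∀ x ∈ A, u x = 0) ∧
      Module.finrank ℂ L ≤ Module.finrank ℂ L' + A.card := by
  let ρ : L →ₗ[ℂ] (A → ℂ) := LinearMap.funLeft ℂ ℂ ((↑) : A → ι) ∘ₗ L.subtype
  refine ⟨(LinearMap.ker ρ).map L.subtype, Submodule.map_subtype_le _ _, ?_, ?_⟩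
  · rintro _ ⟨u, hu, rfl⟩ x hx
    exact congrFun (LinearMap.mem_ker.1 hu) ⟨x, hx⟩
  · rw [Submodule.finrank_map_subtype_eq, ← LinearMap.finrank_range_add_finrank_ker ρ, add_comm]
    have := Submodule.finrank_le (LinearMap.range ρ)
    rw [Module.finrank_fintype_fun_eq_card, Fintype.card_coe] at this
    omega

/-- for `V ∈ ℓ^{d/2}(ℤ^d)`, `s^{d/2} n(s,V) → 0` as `s → 0⁺`,
i.e. `N₋(H_{αV}) = o(α^{d/2})`. -/
theorem discrete_weyl_defect (d : ℕ) (hd : 3 ≤ d) (V : (Fin d → ℤ) → ℝ)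
    (hV : ∀ x, 0 ≤ V x)
    (hsum : (∑' x : Fin d → ℤ, ENNReal.ofReal (V x ^ ((d : ℝ) / 2))) < ⊤) :
    ∀ ε : ℝ, 0 < ε → ∃ s₀ : ℝ, 0 < s₀ ∧
      ∀ s : ℝ, 0 < s → s < s₀ →
      ∀ L : Submodule ℂ ((Fin d → ℤ) → ℂ),
        (∀ u ∈ L, (Function.support u).Finite) →
        FiniteDimensional ℂ L →
        (∀ u ∈ L, u ≠ 0 → ENNReal.ofReal s * Q0 u < bV V u) →
        ENNReal.ofReal (s ^ ((d : ℝ) / 2)) * (Module.finrank ℂ L : ℝ≥0∞) ≤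
          ENNReal.ofReal ε := by
  intro ε hε
  set p : ℝ := (d : ℝ) / 2 with hp
  have hp0 : 0 < p := by positivity
  obtain ⟨K, hK, hclr⟩ := exists_finrank_le_sum_rpow hd
  have hVp : ∀ x, 0 ≤ V x ^ p := fun x => Real.rpow_nonneg (hV x) p
  have hsummable : Summable fun x => V x ^ p := by
    have h := ENNReal.summable_toReal hsum.ne
    simpa only [ENNReal.toReal_ofReal (hVp _)] using h
  obtain ⟨A, hA⟩ := summable_iff_vanishing_norm.1 hsummable (ε / (2 * K)) (by positivity)
  refine ⟨(ε / (2 * (A.card + 1))) ^ p⁻¹, by positivity, fun s hs hs0 L hLs hLfin hL => ?_⟩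
  have hsp : s ^ p * A.card ≤ ε / 2 := by
    have h1 : s ^ p ≤ ε / (2 * (A.card + 1)) := by
      have h2 := Real.rpow_le_rpow hs.le hs0.le hp0.le
      rwa [← Real.rpow_mul (by positivity), inv_mul_cancel₀ hp0.ne', Real.rpow_one] at h2
    rw [le_div_iff₀ (by positivity)] at h1
    have h3 : 0 < s ^ p := Real.rpow_pos_of_pos hs p
    linarith
  obtain ⟨X, hX⟩ := exists_finset_support L hLs
  obtain ⟨L', hL'L, hL'A, hrank⟩ := exists_le_vanishing_finrank L A
  have : FiniteDimensional ℂ L' := Submodule.finiteDimensional_of_le hL'L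
  set W : (Fin d → ℤ) → ℝ := fun x => if x ∈ A then 0 else V x / s with hW
  have hbound := hclr X W (fun x => by
      simp only [hW]
      split_ifs
      exacts [le_rfl, div_nonneg (hV x) hs.le]) L' (fun u hu => hX u (hL'L hu))
    fun u hu hu0 => by
      have h1 := (hL u (hL'L hu) hu0).le
      rw [bV_eq_ofReal_sum hV (hX u (hL'L hu))] at h1
      have h2 : ∑ x ∈ X, V x * ‖u x‖ ^ 2 = s * ∑ x ∈ X, W x * ‖u x‖ ^ 2 := by
        rw [Finset.mul_sum]
        refine Finset.sum_congr rfl fun x _ => ?_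
        by_cases hx : x ∈ A
        · simp [hL'A u hu x hx]
        · simp only [hW, hx, if_false]
          field_simp
      rw [h2, ENNReal.ofReal_mul hs.le] at h1
      exact (ENNReal.mul_le_mul_iff_right (ENNReal.ofReal_pos.2 hs).ne' ENNReal.ofReal_ne_top).1 h1
  have htail : s ^ p * ∑ x ∈ X, W x ^ p ≤ ε / (2 * K) := by
    have h1 : s ^ p * ∑ x ∈ X, W x ^ p = ∑ x ∈ X \ A, V x ^ p := by
      rw [Finset.mul_sum, Finset.sdiff_eq_filter, Finset.sum_filter]
      refine Finset.sum_congr rfl fun x _ => ?_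
      by_cases hx : x ∈ A
      · simp [hW, hx, hp0.ne']
      · simp only [hW, hx, if_false, not_false_eq_true, if_true]
        rw [Real.div_rpow (hV x) hs.le, mul_div_cancel₀ _ (Real.rpow_pos_of_pos hs p).ne']
    rw [h1]
    exact (le_abs_self _).trans (hA _ Finset.sdiff_disjoint).le
  rw [← ENNReal.ofReal_natCast, ← ENNReal.ofReal_mul (Real.rpow_nonneg hs.le p)]
  refine ENNReal.ofReal_le_ofReal ?_
  have h1 : (Module.finrank ℂ L : ℝ) ≤ K * ∑ x ∈ X, W x ^ p + A.card := by
    have : (Module.finrank ℂ L : ℝ) ≤ Module.finrank ℂ L' + A.card := by exact_mod_cast hrank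
    linarith
  calc s ^ p * (Module.finrank ℂ L : ℝ) ≤ s ^ p * (K * ∑ x ∈ X, W x ^ p + A.card) := by gcongr
    _ = K * (s ^ p * ∑ x ∈ X, W x ^ p) + s ^ p * A.card := by ring
    _ ≤ K * (ε / (2 * K)) + ε / 2 := by gcongr
    _ = ε := by field_simp; ring
end
end

section
/- Let d ≥ 3 and 0 < q < d/2. There exists a constant C = C(d,q) such that for every V : ℤ^d → [0,∞) and every s > 0, n(s,V) ≤ C · s^{−q} · sup_{t>0} ( t^q · ν(t,V) ), where the supremum is taken in [0,∞]. Equivalently, N₋(H_{αV}) ≤ C α^q ‖V‖^q_{ℓ_{q,w}} for all α > 0, where ‖V‖_{ℓ_{q,w}} = sup_{t>0} t · ν(t,V)^{1/q}. -/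
open scoped ENNReal NNReal Topology
open Filter MeasureTheory

noncomputable section

/-- The counting function `n(s,V)`: the supremum, in `ℕ∞`, of `dim L` over all
finite-dimensional subspaces `L` of the space of finitely supported functions with
`b_V[u] > s·Q_0[u]` for all nonzero `u ∈ L` (the `s`-admissible subspaces). -/
def nCount (d : ℕ) (V : (Fin d → ℤ) → ℝ) (s : ℝ) : ℕ∞ :=
  ⨆ L : {L : Submodule ℂ ((Fin d → ℤ) → ℂ) //
      (∀ u ∈ L, (Function.support u).Finite) ∧ FiniteDimensional ℂ L ∧
      ∀ u ∈ L, u ≠ 0 → ENNReal.ofReal s * Q0 u < bV V u},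
    (Module.finrank ℂ L.1 : ℕ∞)

/-- `ν(s,V)`: the number (in `ℕ∞`) of lattice points with `V(x) > s`. -/
def nuCount (d : ℕ) (V : (Fin d → ℤ) → ℝ) (s : ℝ) : ℕ∞ :=
  {x : Fin d → ℤ | s < V x}.encard

/-- The Hilbert space `ℓ²(ℤ^d)`. -/
abbrev LatticeL2 (d : ℕ) : Type := lp (fun _ : Fin d → ℤ => ℂ) 2

namespace LatticeL2

variable {d : ℕ}

theorem summable_norm_sq (f : LatticeL2 d) : Summable fun x => ‖f x‖ ^ 2 := by
  have := (memℓp_gen_iff (p := 2) (by norm_num)).1 (lp.memℓp f)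
  simpa using this

theorem norm_sq_eq_tsum (f : LatticeL2 d) : ‖f‖ ^ 2 = ∑' x, ‖f x‖ ^ 2 := by
  have := lp.norm_rpow_eq_tsum (p := 2) (by norm_num) f
  simpa using this

theorem sum_norm_sq_le (f : LatticeL2 d) (s : Finset (Fin d → ℤ)) :
    ∑ x ∈ s, ‖f x‖ ^ 2 ≤ ‖f‖ ^ 2 := by
  have := lp.sum_rpow_le_norm_rpow (p := 2) (by norm_num) f s
  simpa using this

/-- The translation `f ↦ f(· + y)` of `ℓ²(ℤ^d)`. -/
def shift (y : Fin d → ℤ) : LatticeL2 d →ₗᵢ[ℂ] LatticeL2 d where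
  toFun f := ⟨fun x => f (x + y), by
    refine (memℓp_gen_iff (p := 2) (by norm_num)).2 ?_
    simpa [Function.comp_def] using (summable_norm_sq f).comp_injective (add_left_injective y)⟩
  map_add' f g := rfl
  map_smul' c f := rfl
  norm_map' f := by
    refine (sq_eq_sq₀ (norm_nonneg _) (norm_nonneg _)).1 ?_
    rw [norm_sq_eq_tsum, norm_sq_eq_tsum]
    exact (Equiv.addRight y).tsum_eq fun x => ‖f x‖ ^ 2

@[simp]
theorem shift_apply (y : Fin d → ℤ) (f : LatticeL2 d) (x : Fin d → ℤ) :
    shift y f x = f (x + y) := rfl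

theorem shift_zero (f : LatticeL2 d) : shift 0 f = f := by
  ext x; simp

theorem shift_add (y z : Fin d → ℤ) (f : LatticeL2 d) :
    shift (y + z) f = shift y (shift z f) := by
  ext x; simp [add_assoc]

theorem norm_shift_add_sub_le (y z : Fin d → ℤ) (f : LatticeL2 d) :
    ‖shift (y + z) f - f‖ ≤ ‖shift y f - f‖ + ‖shift z f - f‖ := by
  have h : shift (y + z) f - f = shift y (shift z f - f) + (shift y f - f) := by
    rw [shift_add, map_sub]; abel
  rw [h]
  refine (norm_add_le _ _).trans ?_
  rw [(shift y).norm_map, add_comm]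

theorem norm_shift_nsmul_sub_le (n : ℕ) (y : Fin d → ℤ) (f : LatticeL2 d) :
    ‖shift (n • y) f - f‖ ≤ n * ‖shift y f - f‖ := by
  induction n with
  | zero => simp [shift_zero]
  | succ n ih =>
    rw [succ_nsmul]
    refine (norm_shift_add_sub_le _ _ _).trans ?_
    push_cast
    linarith

/-- The cube `{0, …, R - 1}^d`. -/
def cube (d R : ℕ) : Finset (Fin d → ℤ) := Fintype.piFinset fun _ => Finset.Ico (0 : ℤ) R

theorem card_cube (d R : ℕ) : (cube d R).card = R ^ d := by
  simp [cube]

theorem norm_shift_sub_le_of_mem_cube {R : ℕ} {y : Fin d → ℤ} (hy : y ∈ cube d R)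
    {f : LatticeL2 d} {K : ℝ} (hK : ∀ j, ‖shift (latUnit d j) f - f‖ ≤ K) :
    ‖shift y f - f‖ ≤ d * R * K := by
  have hy' : ∀ j, 0 ≤ y j ∧ y j < R := by
    simpa [cube, Fintype.mem_piFinset] using hy
  have hsum : y = ∑ j, (y j).toNat • latUnit d j := by
    ext i
    simp [latUnit, Finset.sum_apply, (hy' i).1]
  have h1 : ‖shift y f - f‖ ≤ ∑ j, ‖shift ((y j).toNat • latUnit d j) f - f‖ := by
    conv_lhs => rw [hsum]
    exact Finset.le_sum_of_subadditive (fun z => ‖shift z f - f‖) (by simp [shift_zero])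
      (fun y z => norm_shift_add_sub_le y z f) _ _
  refine h1.trans ?_
  have h2 : ∀ j ∈ Finset.univ, ‖shift ((y j).toNat • latUnit d j) f - f‖ ≤ R * K := by
    intro j _
    refine (norm_shift_nsmul_sub_le _ _ _).trans ?_
    have : ((y j).toNat : ℝ) ≤ R := by
      have := hy' j
      exact_mod_cast (by omega : (y j).toNat ≤ R)
    exact mul_le_mul this (hK j) (norm_nonneg _) (by positivity)
  refine (Finset.sum_le_sum h2).trans ?_
  simp [mul_assoc]

/-- The average `f ↦ |B|⁻¹ ∑_{y ∈ B} f(· + y)` over the cube `B` of side `R`. -/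
def avg (R : ℕ) : LatticeL2 d →ₗ[ℂ] LatticeL2 d :=
  ((R : ℂ) ^ d)⁻¹ • ∑ y ∈ cube d R, (shift y).toLinearMap

theorem avg_eq (R : ℕ) (f : LatticeL2 d) :
    avg R f = ((R : ℂ) ^ d)⁻¹ • ∑ y ∈ cube d R, shift y f := by
  simp [avg, LinearMap.sum_apply]

theorem avg_apply (R : ℕ) (f : LatticeL2 d) (x : Fin d → ℤ) :
    avg R f x = ((R : ℂ) ^ d)⁻¹ * ∑ y ∈ cube d R, f (x + y) := by
  rw [avg_eq, lp.coeFn_smul, Pi.smul_apply, lp.coeFn_sum, Finset.sum_apply, smul_eq_mul]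
  rfl

theorem avg_comm (R S : ℕ) (f : LatticeL2 d) : avg R (avg S f) = avg S (avg R f) := by
  ext x
  simp only [avg_apply, Finset.mul_sum]
  rw [Finset.sum_comm]
  refine Finset.sum_congr rfl fun y _ => Finset.sum_congr rfl fun z _ => ?_
  rw [add_right_comm]
  ring

theorem norm_avg_apply_sq_le {R : ℕ} (hR : 0 < R) (f : LatticeL2 d) (x : Fin d → ℤ) :
    ‖avg R f x‖ ^ 2 ≤ ((R : ℝ) ^ d)⁻¹ * ‖f‖ ^ 2 := by
  have hR' : (0 : ℝ) < (R : ℝ) ^ d := by positivity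
  have h1 : ‖∑ y ∈ cube d R, f (x + y)‖ ^ 2 ≤ (R : ℝ) ^ d * ‖f‖ ^ 2 := by
    calc ‖∑ y ∈ cube d R, f (x + y)‖ ^ 2 ≤ (∑ y ∈ cube d R, ‖f (x + y)‖) ^ 2 := by
          gcongr; exact norm_sum_le _ _
      _ ≤ (cube d R).card * ∑ y ∈ cube d R, ‖f (x + y)‖ ^ 2 := sq_sum_le_card_mul_sum_sq
      _ ≤ (R : ℝ) ^ d * ‖f‖ ^ 2 := by
          rw [card_cube]
          push_cast
          gcongr
          have := sum_norm_sq_le f ((cube d R).map (addLeftEmbedding x))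
          simpa using this
  rw [avg_apply, norm_mul, mul_pow]
  have h2 : ‖((R : ℂ) ^ d)⁻¹‖ = ((R : ℝ) ^ d)⁻¹ := by simp
  rw [h2]
  calc (((R : ℝ) ^ d)⁻¹) ^ 2 * ‖∑ y ∈ cube d R, f (x + y)‖ ^ 2
      ≤ (((R : ℝ) ^ d)⁻¹) ^ 2 * ((R : ℝ) ^ d * ‖f‖ ^ 2) := by gcongr
    _ = ((R : ℝ) ^ d)⁻¹ * ‖f‖ ^ 2 := by field_simp

theorem norm_sub_avg_le {R : ℕ} (hR : 0 < R) {f : LatticeL2 d} {K : ℝ}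
    (hK : ∀ j, ‖shift (latUnit d j) f - f‖ ≤ K) : ‖f - avg R f‖ ≤ d * R * K := by
  have hR' : (0 : ℝ) < (R : ℝ) ^ d := by positivity
  have hRC : ((R : ℂ) ^ d) ≠ 0 := by
    have : (R : ℂ) ≠ 0 := by exact_mod_cast hR.ne'
    positivity
  have h : f - avg R f = -(((R : ℂ) ^ d)⁻¹ • ∑ y ∈ cube d R, (shift y f - f)) := by
    rw [avg_eq, Finset.sum_sub_distrib, smul_sub, Finset.sum_const, card_cube,
      ← Nat.cast_smul_eq_nsmul ℂ, smul_smul]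
    push_cast
    rw [inv_mul_cancel₀ hRC, one_smul, neg_sub]
  rw [h, norm_neg, norm_smul]
  have h2 : ‖((R : ℂ) ^ d)⁻¹‖ = ((R : ℝ) ^ d)⁻¹ := by simp
  have h3 : ‖∑ y ∈ cube d R, (shift y f - f)‖ ≤ (R : ℝ) ^ d * (d * R * K) := by
    refine (norm_sum_le_of_le _ fun y hy => norm_shift_sub_le_of_mem_cube hy hK).trans ?_
    simp [card_cube]
  rw [h2]
  calc ((R : ℝ) ^ d)⁻¹ * ‖∑ y ∈ cube d R, (shift y f - f)‖
      ≤ ((R : ℝ) ^ d)⁻¹ * ((R : ℝ) ^ d * (d * R * K)) := by gcongr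
    _ = d * R * K := by field_simp

theorem avg_one (f : LatticeL2 d) : avg 1 f = f := by
  have : cube d 1 = {0} := by
    ext y
    simp only [cube, Fintype.mem_piFinset, Finset.mem_Ico, Finset.mem_singleton, funext_iff,
      Pi.zero_apply]
    refine forall_congr' fun i => ?_
    push_cast
    omega
  rw [avg_eq, this]
  simp [shift_zero]

/-- The rate `2 ^ (1 - d / 2)`. -/
def rate (d : ℕ) : ℝ := 2 * √(((2 : ℝ) ^ d)⁻¹)

theorem rate_nonneg (d : ℕ) : 0 ≤ rate d := by unfold rate; positivity

theorem rate_sq (d : ℕ) : rate d ^ 2 = 4 * ((2 : ℝ) ^ d)⁻¹ := by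
  rw [rate, mul_pow, Real.sq_sqrt (by positivity)]
  norm_num

theorem rate_lt_one (hd : 3 ≤ d) : rate d < 1 := by
  have h : (2 : ℝ) ^ 3 ≤ 2 ^ d := pow_le_pow_right₀ (by norm_num) hd
  have h2 : rate d ^ 2 < 1 := by
    rw [rate_sq, ← div_eq_mul_inv, div_lt_one (by positivity)]
    linarith
  exact (sq_lt_one_iff₀ (rate_nonneg d)).1 h2

theorem norm_avg_two_pow_apply_le (k : ℕ) (f : LatticeL2 d) (x : Fin d → ℤ) :
    ‖avg (2 ^ k) f x‖ ≤ √(((2 : ℝ) ^ d)⁻¹) ^ k * ‖f‖ := by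
  refine (sq_le_sq₀ (norm_nonneg _) (by positivity)).1 ?_
  refine (norm_avg_apply_sq_le (by positivity) f x).trans_eq ?_
  rw [mul_pow, ← pow_mul, mul_comm k 2, pow_mul, Real.sq_sqrt (by positivity)]
  push_cast
  rw [← pow_mul, mul_comm k d, pow_mul, inv_pow]

theorem norm_avg_sub_avg_succ_le {f : LatticeL2 d} {K : ℝ}
    (hK : ∀ j, ‖shift (latUnit d j) f - f‖ ≤ K) (k : ℕ) (x : Fin d → ℤ) :
    ‖avg (2 ^ k) f x - avg (2 ^ (k + 1)) f x‖ ≤ 3 * d * K * rate d ^ k := by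
  set a : ℝ := √(((2 : ℝ) ^ d)⁻¹) with ha
  have ha0 : 0 ≤ a := Real.sqrt_nonneg _
  have ha1 : a ≤ 1 := by
    rw [ha, Real.sqrt_le_one]
    exact inv_le_one_of_one_le₀ (one_le_pow₀ (by norm_num))
  have hdK : 0 ≤ d * K := by
    rcases Nat.eq_zero_or_pos d with rfl | hd
    · simp
    · exact mul_nonneg (by positivity) ((norm_nonneg _).trans (hK ⟨0, hd⟩))
  have h : avg (2 ^ k) f - avg (2 ^ (k + 1)) f =
      avg (2 ^ k) (f - avg (2 ^ (k + 1)) f) - avg (2 ^ (k + 1)) (f - avg (2 ^ k) f) := by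
    rw [map_sub, map_sub, avg_comm]
    abel
  have h' : avg (2 ^ k) f x - avg (2 ^ (k + 1)) f x =
      avg (2 ^ k) (f - avg (2 ^ (k + 1)) f) x - avg (2 ^ (k + 1)) (f - avg (2 ^ k) f) x := by
    have := congrArg (fun g : LatticeL2 d => g x) h
    simpa only [lp.coeFn_sub, Pi.sub_apply] using this
  rw [h']
  refine (norm_sub_le _ _).trans ?_
  have h1 := (norm_avg_two_pow_apply_le k (f - avg (2 ^ (k + 1)) f) x).trans
    (mul_le_mul_of_nonneg_left (norm_sub_avg_le (by positivity) hK) (by positivity))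
  have h2 := (norm_avg_two_pow_apply_le (k + 1) (f - avg (2 ^ k) f) x).trans
    (mul_le_mul_of_nonneg_left (norm_sub_avg_le (by positivity) hK) (by positivity))
  refine (add_le_add h1 h2).trans ?_
  rw [rate, ← ha, mul_pow]
  push_cast
  have h3 : a * (a ^ k * (d * K) * 2 ^ k) ≤ 1 * (a ^ k * (d * K) * 2 ^ k) := by gcongr
  rw [pow_succ, pow_succ]
  linarith

theorem norm_avg_apply_le (hd : 3 ≤ d) {f : LatticeL2 d} {K : ℝ}
    (hK : ∀ j, ‖shift (latUnit d j) f - f‖ ≤ K) (k : ℕ) (x : Fin d → ℤ) :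
    ‖avg (2 ^ k) f x‖ ≤ 3 * d / (1 - rate d) * rate d ^ k * K := by
  have hr0 := rate_nonneg d
  have hr1 := rate_lt_one hd
  set c : ℝ := 3 * d / (1 - rate d) * K with hc
  have hc' : c * (1 - rate d) = 3 * d * K := by
    have : 1 - rate d ≠ 0 := by linarith
    rw [hc]; field_simp
  set b : ℕ → ℝ := fun k => ‖avg (2 ^ k) f x‖ - c * rate d ^ k with hb
  have hmono : Monotone b := by
    refine monotone_nat_of_le_succ fun k => ?_
    have h1 := norm_avg_sub_avg_succ_le hK k x
    have h2 := norm_sub_norm_le (avg (2 ^ k) f x) (avg (2 ^ (k + 1)) f x)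
    have h3 : c * rate d ^ k - c * rate d ^ (k + 1) = 3 * d * K * rate d ^ k := by
      rw [← hc']; ring
    simp only [hb]
    linarith
  have hlim : Tendsto b atTop (𝓝 (0 - c * 0)) := by
    refine Tendsto.sub ?_ ((tendsto_pow_atTop_nhds_zero_of_lt_one hr0 hr1).const_mul c)
    refine squeeze_zero (fun _ => norm_nonneg _) (fun k => norm_avg_two_pow_apply_le k f x) ?_
    rw [← zero_mul ‖f‖]
    refine (tendsto_pow_atTop_nhds_zero_of_lt_one (Real.sqrt_nonneg _) ?_).mul_const _
    unfold rate at hr1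
    have := Real.sqrt_nonneg (((2 : ℝ) ^ d)⁻¹)
    linarith
  have := hmono.ge_of_tendsto hlim k
  simp only [hb] at this
  have e : 3 * d / (1 - rate d) * rate d ^ k * K = c * rate d ^ k := by rw [hc]; ring
  rw [e]
  linarith

end LatticeL2

/-- If `G v_n` are orthonormal and the functional `φ` satisfies `‖φ u‖ ≤ C ‖G u‖`, then
`∑ ‖φ v_n‖² ≤ C²`. -/
theorem sum_norm_sq_le_of_orthonormal {M E ι : Type*} [AddCommGroup M] [Module ℂ M]
    [NormedAddCommGroup E] [InnerProductSpace ℂ E] [Fintype ι] (G : M →ₗ[ℂ] E) (φ : M →ₗ[ℂ] ℂ)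
    {C : ℝ} (hφ : ∀ u, ‖φ u‖ ≤ C * ‖G u‖) {v : ι → M}
    (hv : Orthonormal ℂ fun n => G (v n)) :
    ∑ n, ‖φ (v n)‖ ^ 2 ≤ C ^ 2 := by
  set S : ℝ := ∑ n, ‖φ (v n)‖ ^ 2 with hS
  have hS0 : 0 ≤ S := Finset.sum_nonneg fun _ _ => by positivity
  set u : M := ∑ n, (starRingEnd ℂ) (φ (v n)) • v n with hu
  have h1 : φ u = (S : ℂ) := by
    rw [hu, map_sum, hS]
    push_cast
    refine Finset.sum_congr rfl fun n _ => ?_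
    rw [map_smul, smul_eq_mul, mul_comm, Complex.mul_conj, Complex.normSq_eq_norm_sq]
    push_cast; rfl
  have h2 : ‖G u‖ ^ 2 = S := by
    have h3 : inner ℂ (G u) (G u) = (S : ℂ) := by
      rw [hu, map_sum]
      simp only [map_smul]
      rw [hv.inner_sum, hS]
      push_cast
      refine Finset.sum_congr rfl fun n _ => ?_
      rw [mul_comm, Complex.mul_conj, Complex.normSq_conj, Complex.normSq_eq_norm_sq]
      push_cast; rfl
    rw [@norm_sq_eq_re_inner ℂ, h3]
    exact Complex.ofReal_re S
  have h4 := hφ u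
  rw [h1, Complex.norm_of_nonneg hS0] at h4
  rcases hS0.eq_or_lt with h0 | h0
  · rw [← h0]; positivity
  · have h5 : S ^ 2 ≤ C ^ 2 * S := by
      rw [← h2] at h4 ⊢
      rw [← mul_pow]
      exact pow_le_pow_left₀ (by positivity) h4 2
    nlinarith

namespace LatticeL2

variable {d : ℕ}

/-- The discrete gradient `f ↦ (f(· + 1_j) - f)_j`. -/
def grad : LatticeL2 d →ₗ[ℂ] PiLp 2 fun _ : Fin d => LatticeL2 d :=
  (WithLp.linearEquiv 2 ℂ (Fin d → LatticeL2 d)).symm.toLinearMap ∘ₗ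
    LinearMap.pi fun j => (shift (latUnit d j)).toLinearMap - LinearMap.id

theorem grad_apply (f : LatticeL2 d) (j : Fin d) : grad f j = shift (latUnit d j) f - f := rfl

theorem norm_shift_latUnit_sub_le (f : LatticeL2 d) (j : Fin d) :
    ‖shift (latUnit d j) f - f‖ ≤ ‖grad f‖ := by
  rw [← grad_apply]; exact PiLp.norm_apply_le _ _

theorem ofReal_norm_sq_eq_tsum (f : LatticeL2 d) :
    ENNReal.ofReal (‖f‖ ^ 2) = ∑' x, (‖f x‖₊ : ℝ≥0∞) ^ 2 := by
  rw [norm_sq_eq_tsum, ENNReal.ofReal_tsum_of_nonneg (fun _ => by positivity) (summable_norm_sq f)]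
  refine tsum_congr fun x => ?_
  rw [ENNReal.ofReal_pow (norm_nonneg _), ofReal_norm]
  rfl

theorem ofReal_norm_grad_sq (f : LatticeL2 d) : ENNReal.ofReal (‖grad f‖ ^ 2) = Q0 ⇑f := by
  rw [PiLp.norm_sq_eq_of_L2, ENNReal.ofReal_sum_of_nonneg fun _ _ => by positivity, Q0,
    Summable.tsum_finsetSum fun _ _ => ENNReal.summable]
  refine Finset.sum_congr rfl fun j _ => ?_
  rw [ofReal_norm_sq_eq_tsum]
  rfl

theorem grad_injective (hd : 3 ≤ d) : Function.Injective (grad (d := d)) := by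
  rw [← LinearMap.ker_eq_bot, LinearMap.ker_eq_bot']
  intro f hf
  ext x
  have h := norm_avg_apply_le hd (norm_shift_latUnit_sub_le f) 0 x
  rw [pow_zero, avg_one, hf, norm_zero, mul_zero] at h
  simpa using h

/-- The constant in `norm_avg_apply_le`. -/
def avgConst (d : ℕ) : ℝ := 3 * d / (1 - rate d)

/-- Evaluation at a point as a linear functional. -/
def pointEval (x : Fin d → ℤ) : LatticeL2 d →ₗ[ℂ] ℂ where
  toFun f := f x
  map_add' _ _ := rfl
  map_smul' _ _ := rfl

theorem sum_density_le (hd : 3 ≤ d) {ι : Type*} [Fintype ι] {v : ι → LatticeL2 d}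
    (hv : Orthonormal ℂ fun n => grad (v n)) (k : ℕ) (s : Finset (Fin d → ℤ)) :
    ∑ x ∈ s, ∑ n, ‖v n x‖ ^ 2 ≤
      2 * (s.card * (avgConst d ^ 2 * rate d ^ (2 * k)) +
        Fintype.card ι * (d ^ 2 * 4 ^ k)) := by
  have hlow : ∀ x, ∑ n, ‖avg (2 ^ k) (v n) x‖ ^ 2 ≤ avgConst d ^ 2 * rate d ^ (2 * k) := by
    intro x
    rw [mul_comm 2 k, pow_mul, ← mul_pow]
    exact sum_norm_sq_le_of_orthonormal grad (pointEval x ∘ₗ avg (2 ^ k))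
      (fun u => norm_avg_apply_le hd (norm_shift_latUnit_sub_le u) k x) hv
  have hhigh : ∀ n, ∑ x ∈ s, ‖(v n - avg (2 ^ k) (v n)) x‖ ^ 2 ≤ d ^ 2 * 4 ^ k := by
    intro n
    refine (sum_norm_sq_le _ s).trans ?_
    have h := norm_sub_avg_le (R := 2 ^ k) (by positivity) (norm_shift_latUnit_sub_le (v n))
    have h1 : ‖grad (v n)‖ = 1 := hv.1 n
    rw [h1, mul_one] at h
    refine (pow_le_pow_left₀ (norm_nonneg _) h 2).trans_eq ?_
    push_cast
    rw [mul_pow, ← pow_mul, mul_comm k 2, pow_mul]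
    norm_num
  have hsplit : ∀ x n, ‖v n x‖ ^ 2 ≤
      2 * (‖avg (2 ^ k) (v n) x‖ ^ 2 + ‖(v n - avg (2 ^ k) (v n)) x‖ ^ 2) := by
    intro x n
    have h : v n x = avg (2 ^ k) (v n) x + (v n - avg (2 ^ k) (v n)) x := by
      rw [lp.coeFn_sub, Pi.sub_apply]; ring
    have h2 := norm_add_le (avg (2 ^ k) (v n) x) ((v n - avg (2 ^ k) (v n)) x)
    rw [← h] at h2
    exact (pow_le_pow_left₀ (norm_nonneg _) h2 2).trans add_sq_le
  calc ∑ x ∈ s, ∑ n, ‖v n x‖ ^ 2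
      ≤ ∑ x ∈ s, ∑ n, 2 * (‖avg (2 ^ k) (v n) x‖ ^ 2 + ‖(v n - avg (2 ^ k) (v n)) x‖ ^ 2) :=
        Finset.sum_le_sum fun x _ => Finset.sum_le_sum fun n _ => hsplit x n
    _ = 2 * (∑ x ∈ s, ∑ n, ‖avg (2 ^ k) (v n) x‖ ^ 2 +
          ∑ n, ∑ x ∈ s, ‖(v n - avg (2 ^ k) (v n)) x‖ ^ 2) := by
        rw [Finset.sum_comm (s := Finset.univ) (t := s)]
        simp only [← Finset.mul_sum, Finset.sum_add_distrib]
    _ ≤ _ := by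
        gcongr
        · refine (Finset.sum_le_sum fun x _ => hlow x).trans ?_
          simp
        · refine (Finset.sum_le_sum fun n _ => hhigh n).trans ?_
          simp

/-- Finitely supported functions as elements of `ℓ²(ℤ^d)`. -/
def ofFinitelySupported {L : Submodule ℂ ((Fin d → ℤ) → ℂ)}
    (hL : ∀ u ∈ L, (Function.support u).Finite) : L →ₗ[ℂ] LatticeL2 d where
  toFun u := ⟨u.1, (memℓp_zero (hL u.1 u.2)).of_exponent_ge (by simp)⟩
  map_add' _ _ := rfl
  map_smul' _ _ := rfl

end LatticeL2

theorem exists_orthonormal_comp {K E : Type*} [AddCommGroup K] [Module ℂ K]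
    [FiniteDimensional ℂ K] [NormedAddCommGroup E] [InnerProductSpace ℂ E] (G : K →ₗ[ℂ] E)
    (hG : Function.Injective G) :
    ∃ v : Fin (Module.finrank ℂ K) → K, Orthonormal ℂ fun n => G (v n) := by
  have hr : Module.finrank ℂ (LinearMap.range G) = Module.finrank ℂ K :=
    LinearMap.finrank_range_of_inj hG
  let b := (stdOrthonormalBasis ℂ (LinearMap.range G)).reindex (finCongr hr)
  choose v hv using fun n => (b n).2
  refine ⟨v, ?_⟩
  simp only [hv]
  exact b.orthonormal.comp_linearIsometry (LinearMap.range G).subtypeₗᵢ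

theorem finrank_le_finrank_ker_restrict_add {X : Type*} (L : Submodule ℂ (X → ℂ))
    [FiniteDimensional ℂ L] (s : Finset X) :
    ∃ K : Submodule ℂ (X → ℂ), K ≤ L ∧ (∀ u ∈ K, ∀ x ∈ s, u x = 0) ∧ FiniteDimensional ℂ K ∧
      Module.finrank ℂ L ≤ Module.finrank ℂ K + s.card := by
  let ρ : L →ₗ[ℂ] (s → ℂ) := LinearMap.funLeft ℂ ℂ (Subtype.val : s → X) ∘ₗ L.subtype
  refine ⟨(LinearMap.ker ρ).map L.subtype, Submodule.map_subtype_le _ _, ?_, inferInstance, ?_⟩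
  · rintro _ ⟨u, hu, rfl⟩ x hx
    exact congrFun (LinearMap.mem_ker.1 hu) ⟨x, hx⟩
  · have h1 := LinearMap.finrank_range_add_finrank_ker ρ
    have h2 : Module.finrank ℂ (LinearMap.range ρ) ≤ s.card := by
      refine (Submodule.finrank_le _).trans ?_
      simp
    have h3 : Module.finrank ℂ ((LinearMap.ker ρ).map L.subtype) =
        Module.finrank ℂ (LinearMap.ker ρ) :=
      (Submodule.equivMapOfInjective _ L.injective_subtype _).finrank_eq.symm
    omega

theorem exists_scale_summable {d : ℕ} (hd : 3 ≤ d) {q : ℝ} (hq' : q < (d : ℝ) / 2) :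
    ∃ j : ℕ → ℕ, (Summable fun k => ((2 : ℝ) ^ k)⁻¹ * 4 ^ j k) ∧
      Summable fun k => ((2 : ℝ) ^ k)⁻¹ * ((2 : ℝ) ^ k) ^ q * LatticeL2.rate d ^ (2 * j k) := by
  have hd' : (3 : ℝ) ≤ d := by exact_mod_cast hd
  obtain ⟨l, hl1, hl2⟩ : ∃ l : ℝ, max 0 ((q - 1) / (d - 2)) < l ∧ l < 1 / 2 := by
    refine exists_between (max_lt (by norm_num) ?_)
    rw [div_lt_iff₀ (by linarith)]
    linarith
  have hl0 : 0 < l := (le_max_left _ _).trans_lt hl1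
  have hlq : q - 1 < l * (d - 2) := by
    rw [← div_lt_iff₀ (by linarith)]
    exact (le_max_right _ _).trans_lt hl1
  have hinv : ∀ k : ℕ, ((2 : ℝ) ^ k)⁻¹ = (2 : ℝ) ^ (-(k : ℝ)) := fun k => by
    rw [Real.rpow_neg (by norm_num), Real.rpow_natCast]
  have hgeom : ∀ a : ℝ, a < 0 → Summable fun k : ℕ => (2 : ℝ) ^ (a * k) := fun a ha => by
    have := summable_geometric_of_lt_one (r := (2 : ℝ) ^ a) (by positivity)
      (Real.rpow_lt_one_of_one_lt_of_neg (by norm_num) ha)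
    refine this.congr fun k => ?_
    rw [Real.rpow_mul (by norm_num), Real.rpow_natCast]
  refine ⟨fun k => ⌊l * k⌋₊, ?_, ?_⟩
  · refine Summable.of_nonneg_of_le (fun k => by positivity) (fun k => ?_)
      (hgeom (2 * l - 1) (by linarith))
    have h4 : (4 : ℝ) ^ ⌊l * k⌋₊ = (2 : ℝ) ^ (2 * (⌊l * k⌋₊ : ℝ)) := by
      rw [Real.rpow_mul (by norm_num), Real.rpow_natCast]; norm_num
    rw [hinv, h4, ← Real.rpow_add (by norm_num)]
    refine Real.rpow_le_rpow_of_exponent_le (by norm_num) ?_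
    have := Nat.floor_le (a := l * k) (by positivity)
    linarith
  · refine Summable.of_nonneg_of_le (fun k => ?_) (fun k => ?_)
      ((hgeom (q - 1 - l * (d - 2)) (by linarith)).mul_left ((2 : ℝ) ^ ((d : ℝ) - 2)))
    · have := LatticeL2.rate_nonneg d
      positivity
    have h4 : LatticeL2.rate d ^ (2 * ⌊l * k⌋₊) =
        (2 : ℝ) ^ ((2 - (d : ℝ)) * (⌊l * k⌋₊ : ℝ)) := by
      rw [Real.rpow_mul (by norm_num), Real.rpow_natCast, pow_mul, LatticeL2.rate_sq,
        Real.rpow_sub (by norm_num), Real.rpow_natCast]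
      norm_num [div_eq_mul_inv]
    rw [hinv, h4, ← Real.rpow_natCast, ← Real.rpow_mul (by norm_num),
      ← Real.rpow_add (by norm_num), ← Real.rpow_add (by norm_num),
      ← Real.rpow_add (by norm_num)]
    refine Real.rpow_le_rpow_of_exponent_le (by norm_num) ?_
    have := (Nat.sub_one_lt_floor (l * k)).le
    nlinarith

theorem ofReal_le_tsum_dyadic {w τ : ℝ} (hw : w ≤ τ) (hτ : 0 < τ) :
    ENNReal.ofReal w ≤
      ∑' k : ℕ, if τ * ((2 : ℝ) ^ (k + 1))⁻¹ < w then ENNReal.ofReal (τ * ((2 : ℝ) ^ k)⁻¹)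
        else 0 := by
  classical
  rcases le_or_gt w 0 with h0 | h0
  · rw [ENNReal.ofReal_of_nonpos h0]; exact zero_le
  have hex : ∃ k : ℕ, τ * ((2 : ℝ) ^ (k + 1))⁻¹ < w := by
    obtain ⟨k, hk⟩ := pow_unbounded_of_one_lt (τ / w) (one_lt_two : (1 : ℝ) < 2)
    refine ⟨k, ?_⟩
    rw [← div_eq_mul_inv, div_lt_iff₀ (by positivity)]
    rw [div_lt_iff₀ h0] at hk
    rw [pow_succ]
    nlinarith [pow_pos (two_pos : (0 : ℝ) < 2) k]
  have hle : w ≤ τ * ((2 : ℝ) ^ Nat.find hex)⁻¹ := by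
    rcases Nat.eq_zero_or_eq_succ_pred (Nat.find hex) with h | h
    · rw [h]; simpa using hw
    · rw [h]
      exact not_lt.1 (Nat.find_min hex (Nat.pred_lt (by omega)))
  refine le_trans ?_ (ENNReal.le_tsum (Nat.find hex))
  rw [if_pos (Nat.find_spec hex)]
  exact ENNReal.ofReal_le_ofReal hle

theorem LatticeL2.sum_bV_le {d : ℕ} (hd : 3 ≤ d) {ι : Type*} [Fintype ι] {v : ι → LatticeL2 d}
    (hv : Orthonormal ℂ fun n => grad (v n)) {V : (Fin d → ℤ) → ℝ} {τ : ℝ} (hτ : 0 < τ)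
    (hV : ∀ x, V x ≤ τ ∨ ∀ n, v n x = 0) (Ω : ℕ → Finset (Fin d → ℤ))
    (hΩ : ∀ k x, x ∈ Ω k ↔ τ * ((2 : ℝ) ^ (k + 1))⁻¹ < V x) (j : ℕ → ℕ) :
    ∑ n, bV V (v n) ≤ ∑' k, ENNReal.ofReal (τ * ((2 : ℝ) ^ k)⁻¹ *
      (2 * ((Ω k).card * (avgConst d ^ 2 * rate d ^ (2 * j k)) +
        Fintype.card ι * (d ^ 2 * 4 ^ j k)))) := by
  classical
  set g : (Fin d → ℤ) → ℝ := fun x => ∑ n, ‖v n x‖ ^ 2 with hg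
  have hg0 : ∀ x, 0 ≤ g x := fun x => Finset.sum_nonneg fun _ _ => by positivity
  have h1 : ∑ n, bV V (v n) = ∑' x, ENNReal.ofReal (V x) * ENNReal.ofReal (g x) := by
    simp only [bV]
    rw [← Summable.tsum_finsetSum fun _ _ => ENNReal.summable]
    refine tsum_congr fun x => ?_
    rw [← Finset.mul_sum, hg, ENNReal.ofReal_sum_of_nonneg fun _ _ => by positivity]
    congr 1
    refine Finset.sum_congr rfl fun n _ => ?_
    rw [ENNReal.ofReal_pow (norm_nonneg _), ofReal_norm]
    rfl
  have h2 : ∀ x, ENNReal.ofReal (V x) * ENNReal.ofReal (g x) ≤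
      ∑' k, if x ∈ Ω k then ENNReal.ofReal (τ * ((2 : ℝ) ^ k)⁻¹) * ENNReal.ofReal (g x)
        else 0 := by
    intro x
    rcases hV x with h | h
    · refine (mul_le_mul_left (ofReal_le_tsum_dyadic h hτ) _).trans_eq ?_
      rw [← ENNReal.tsum_mul_right]
      refine tsum_congr fun k => ?_
      simp only [hΩ, ite_mul, zero_mul]
    · have : g x = 0 := by simp [hg, h]
      simp [this]
  rw [h1]
  refine (ENNReal.tsum_le_tsum h2).trans ?_
  rw [ENNReal.tsum_comm]
  refine ENNReal.tsum_le_tsum fun k => ?_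
  rw [tsum_eq_sum (s := Ω k) fun x hx => if_neg hx]
  rw [Finset.sum_congr rfl fun x hx => if_pos hx, ← Finset.mul_sum,
    ← ENNReal.ofReal_sum_of_nonneg fun x _ => hg0 x, ← ENNReal.ofReal_mul (by positivity)]
  refine ENNReal.ofReal_le_ofReal (mul_le_mul_of_nonneg_left ?_ (by positivity))
  exact sum_density_le hd hv (j k) (Ω k)

/-- The dimension bound for subspaces of functions vanishing where `V > τ`, in terms of the
dyadic level sets of `V`. -/
theorem finrank_mul_le {d : ℕ} (hd : 3 ≤ d) {K : Submodule ℂ ((Fin d → ℤ) → ℂ)}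
    [FiniteDimensional ℂ K] (hfin : ∀ u ∈ K, (Function.support u).Finite)
    {V : (Fin d → ℤ) → ℝ} {s : ℝ}
    (hK : ∀ u ∈ K, u ≠ 0 → ENNReal.ofReal s * Q0 u < bV V u)
    {τ : ℝ} (hτ : 0 < τ) (hV : ∀ x, τ < V x → ∀ u ∈ K, u x = 0) (Ω : ℕ → Finset (Fin d → ℤ))
    (hΩ : ∀ k x, x ∈ Ω k ↔ τ * ((2 : ℝ) ^ (k + 1))⁻¹ < V x) {m q : ℝ} (hm : 0 ≤ m)
    (hcard : ∀ k, ((Ω k).card : ℝ) ≤ m * ((2 : ℝ) ^ k) ^ q) {j : ℕ → ℕ}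
    (hj1 : Summable fun k => ((2 : ℝ) ^ k)⁻¹ * 4 ^ j k)
    (hj2 : Summable fun k => ((2 : ℝ) ^ k)⁻¹ * ((2 : ℝ) ^ k) ^ q *
      LatticeL2.rate d ^ (2 * j k)) :
    Module.finrank ℂ K * s ≤
      τ * (2 * (m * LatticeL2.avgConst d ^ 2 *
          ∑' k, ((2 : ℝ) ^ k)⁻¹ * ((2 : ℝ) ^ k) ^ q * LatticeL2.rate d ^ (2 * j k) +
        Module.finrank ℂ K * d ^ 2 * ∑' k, ((2 : ℝ) ^ k)⁻¹ * 4 ^ j k)) := by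
  have hr := LatticeL2.rate_nonneg d
  set N := Module.finrank ℂ K with hN
  let e := LatticeL2.ofFinitelySupported hfin
  have he : Function.Injective e := fun u v h => 
    Subtype.ext (congrArg (fun f : LatticeL2 d => (f : (Fin d → ℤ) → ℂ)) h)
  obtain ⟨v, hv⟩ := exists_orthonormal_comp (LatticeL2.grad ∘ₗ e)
    ((LatticeL2.grad_injective hd).comp he)
  have hv' : Orthonormal ℂ fun n => LatticeL2.grad (e (v n)) := hv
  have hlow : ∀ n, ENNReal.ofReal s ≤ bV V (e (v n)) := by
    intro n
    have h0 : (v n).1 ≠ 0 := by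
      intro h
      have h2 : v n = 0 := Subtype.ext h
      have h3 := hv'.ne_zero n
      simp [h2] at h3
    have h1 := (hK _ (v n).2 h0).le
    have h2 : Q0 (v n).1 = 1 := by
      have h3 : ENNReal.ofReal (‖LatticeL2.grad (e (v n))‖ ^ 2) = Q0 (v n).1 :=
        LatticeL2.ofReal_norm_grad_sq (e (v n))
      have h4 : ‖LatticeL2.grad (e (v n))‖ = 1 := hv'.1 n
      rw [h4] at h3
      simpa using h3.symm
    rw [h2, mul_one] at h1
    exact h1
  have hup := LatticeL2.sum_bV_le hd hv' (V := V) hτ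
    (fun x => (le_or_gt (V x) τ).imp_right fun h n => hV x h _ (v n).2) Ω hΩ j
  have hsum : HasSum (fun k => τ * (2 * (m * LatticeL2.avgConst d ^ 2 *
          (((2 : ℝ) ^ k)⁻¹ * ((2 : ℝ) ^ k) ^ q * LatticeL2.rate d ^ (2 * j k)) +
        N * d ^ 2 * (((2 : ℝ) ^ k)⁻¹ * 4 ^ j k))))
      (τ * (2 * (m * LatticeL2.avgConst d ^ 2 *
          ∑' k, ((2 : ℝ) ^ k)⁻¹ * ((2 : ℝ) ^ k) ^ q * LatticeL2.rate d ^ (2 * j k) +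
        N * d ^ 2 * ∑' k, ((2 : ℝ) ^ k)⁻¹ * 4 ^ j k))) :=
    (((hj2.hasSum.mul_left _).add (hj1.hasSum.mul_left _)).mul_left 2).mul_left τ
  have hterm : ∀ k, τ * ((2 : ℝ) ^ k)⁻¹ *
      (2 * ((Ω k).card * (LatticeL2.avgConst d ^ 2 * LatticeL2.rate d ^ (2 * j k)) +
        Fintype.card (Fin N) * (d ^ 2 * 4 ^ j k))) ≤
      τ * (2 * (m * LatticeL2.avgConst d ^ 2 *
          (((2 : ℝ) ^ k)⁻¹ * ((2 : ℝ) ^ k) ^ q * LatticeL2.rate d ^ (2 * j k)) +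
        N * d ^ 2 * (((2 : ℝ) ^ k)⁻¹ * 4 ^ j k))) := by
    intro k
    calc _ ≤ τ * ((2 : ℝ) ^ k)⁻¹ * (2 * (m * ((2 : ℝ) ^ k) ^ q *
            (LatticeL2.avgConst d ^ 2 * LatticeL2.rate d ^ (2 * j k)) +
          Fintype.card (Fin N) * (d ^ 2 * 4 ^ j k))) := by
          gcongr
          exact hcard k
      _ = _ := by rw [Fintype.card_fin]; ring
  have hnn : ∀ k, 0 ≤ τ * (2 * (m * LatticeL2.avgConst d ^ 2 *
          (((2 : ℝ) ^ k)⁻¹ * ((2 : ℝ) ^ k) ^ q * LatticeL2.rate d ^ (2 * j k)) +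
        N * d ^ 2 * (((2 : ℝ) ^ k)⁻¹ * 4 ^ j k))) := fun k => by positivity
  have hfinal : ENNReal.ofReal (N * s) ≤ ENNReal.ofReal (τ * (2 * (m * LatticeL2.avgConst d ^ 2 *
          ∑' k, ((2 : ℝ) ^ k)⁻¹ * ((2 : ℝ) ^ k) ^ q * LatticeL2.rate d ^ (2 * j k) +
        N * d ^ 2 * ∑' k, ((2 : ℝ) ^ k)⁻¹ * 4 ^ j k))) := by
    rw [← hsum.tsum_eq, ENNReal.ofReal_tsum_of_nonneg hnn hsum.summable]
    refine le_trans ?_ (hup.trans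
      (ENNReal.tsum_le_tsum fun k => ENNReal.ofReal_le_ofReal (hterm k)))
    refine le_trans ?_ (Finset.sum_le_sum fun n _ => hlow n)
    rw [ENNReal.ofReal_mul (by positivity)]
    simp [N]
  refine (ENNReal.ofReal_le_ofReal_iff ?_).1 hfinal
  rw [← hsum.tsum_eq]
  exact tsum_nonneg hnn

/-- for `0 < q < d/2`,
`n(s,V) ≤ C s^{−q} sup_{t>0} t^q ν(t,V)`, i.e. `N₋(H_{αV}) ≤ C α^q ‖V‖^q_{ℓ_{q,w}}`. -/
theorem estimate_small_q (d : ℕ) (hd : 3 ≤ d) (q : ℝ) (hq : 0 < q)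
    (hq' : q < (d : ℝ) / 2) :
    ∃ C : ℝ, 0 < C ∧
      ∀ V : (Fin d → ℤ) → ℝ, (∀ x, 0 ≤ V x) →
      ∀ s : ℝ, 0 < s →
        (nCount d V s : ℝ≥0∞) ≤
          ENNReal.ofReal C * ENNReal.ofReal s ^ (-q) *
            ⨆ t : {t : ℝ // 0 < t},
              ENNReal.ofReal (t.1 ^ q) * (nuCount d V t.1 : ℝ≥0∞) := by
  obtain ⟨j, hj1, hj2⟩ := exists_scale_summable hd hq'
  have hr := LatticeL2.rate_nonneg d
  set S₁ : ℝ := ∑' k, ((2 : ℝ) ^ k)⁻¹ * 4 ^ j k with hS₁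
  set S₂ : ℝ := ∑' k, ((2 : ℝ) ^ k)⁻¹ * ((2 : ℝ) ^ k) ^ q * LatticeL2.rate d ^ (2 * j k) with hS₂
  have hS₁0 : 0 ≤ S₁ := tsum_nonneg fun k => by positivity
  have hS₂0 : 0 ≤ S₂ := tsum_nonneg fun k => by positivity
  set θ : ℝ := (4 * d ^ 2 * S₁ + 1)⁻¹ with hθ
  have hθ0 : 0 < θ := by positivity
  have hθ1 : θ * (4 * d ^ 2 * S₁) ≤ 1 := by
    rw [hθ, inv_mul_le_iff₀ (by positivity)]; linarith
  set C : ℝ := θ ^ (-q) + 4 * θ * (θ ^ (-q) * 2 ^ q) * LatticeL2.avgConst d ^ 2 * S₂ with hC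
  refine ⟨C, by positivity, fun V hV s hs => ?_⟩
  set M : ℝ≥0∞ := ⨆ t : {t : ℝ // 0 < t},
    ENNReal.ofReal (t.1 ^ q) * (nuCount d V t.1 : ℝ≥0∞) with hM
  rw [ENNReal.ofReal_rpow_of_pos hs]
  rcases eq_or_ne M ⊤ with hMtop | hMtop
  · rw [hMtop, ENNReal.mul_top]
    · exact le_top
    · rw [← ENNReal.ofReal_mul (by positivity)]
      exact (ENNReal.ofReal_pos.2 (by positivity)).ne'
  set m : ℝ := M.toReal with hm
  have hm0 : 0 ≤ m := ENNReal.toReal_nonneg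
  have hMm : M = ENNReal.ofReal m := (ENNReal.ofReal_toReal hMtop).symm
  have hnu : ∀ t : ℝ, 0 < t → (nuCount d V t : ℝ≥0∞) ≤ ENNReal.ofReal (t ^ (-q) * m) := by
    intro t ht
    have h1 : ENNReal.ofReal (t ^ q) * (nuCount d V t : ℝ≥0∞) ≤ ENNReal.ofReal m := by
      rw [← hMm]
      exact le_iSup (fun t : {t : ℝ // 0 < t} =>
        ENNReal.ofReal (t.1 ^ q) * (nuCount d V t.1 : ℝ≥0∞)) ⟨t, ht⟩
    have h2 := mul_le_mul_right h1 (ENNReal.ofReal (t ^ (-q)))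
    rwa [← mul_assoc, ← ENNReal.ofReal_mul (by positivity), ← ENNReal.ofReal_mul (by positivity),
      ← Real.rpow_add ht, neg_add_cancel, Real.rpow_zero, ENNReal.ofReal_one, one_mul] at h2
  have hset : ∀ t : ℝ, 0 < t → ∃ F : Finset (Fin d → ℤ), (∀ x, x ∈ F ↔ t < V x) ∧
      (F.card : ℝ) ≤ t ^ (-q) * m := by
    intro t ht
    have hfin : {x | t < V x}.Finite := by
      rw [← Set.encard_ne_top_iff, ← ENat.toENNReal_ne_top]
      exact ((hnu t ht).trans_lt ENNReal.ofReal_lt_top).ne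
    refine ⟨hfin.toFinset, by simp, ?_⟩
    have h := hnu t ht
    rw [nuCount, hfin.encard_eq_coe_toFinset_card, ENat.toENNReal_coe,
      ← ENNReal.ofReal_natCast] at h
    exact (ENNReal.ofReal_le_ofReal_iff (by positivity)).1 h
  have hτ : 0 < θ * s := by positivity
  obtain ⟨F, hF, hFcard⟩ := hset (θ * s) hτ
  choose Ω hΩ hΩcard using fun k : ℕ => hset (θ * s * ((2 : ℝ) ^ (k + 1))⁻¹) (by positivity)
  rw [hMm, ← ENNReal.ofReal_mul (by positivity), ← ENNReal.ofReal_mul (by positivity), nCount,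
    ENat.toENNReal_iSup]
  refine iSup_le ?_
  rintro ⟨L, hLfin, hLdim, hL⟩
  obtain ⟨K, hKL, hKF, hKdim, hrank⟩ := finrank_le_finrank_ker_restrict_add L F
  have hmain := finrank_mul_le hd (fun u hu => hLfin u (hKL hu)) (fun u hu => hL u (hKL hu)) hτ
    (fun x hx u hu => hKF u hu x ((hF x).2 hx)) Ω hΩ
    (m := (θ ^ (-q) * 2 ^ q) * (s ^ (-q) * m)) (by positivity) (q := q) (fun k => by
      refine (hΩcard k).trans_eq ?_
      have h2k : ((2 : ℝ) ^ (k + 1))⁻¹ ^ (-q) = (2 ^ k) ^ q * 2 ^ q := by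
        rw [Real.inv_rpow (by positivity), ← Real.rpow_neg (by positivity), neg_neg, pow_succ,
          Real.mul_rpow (by positivity) (by positivity)]
      rw [Real.mul_rpow (by positivity) (by positivity), Real.mul_rpow hθ0.le hs.le, h2k]
      ring) hj1 hj2
  rw [← hS₁, ← hS₂] at hmain
  set N : ℝ := ((Module.finrank ℂ K : ℕ) : ℝ) with hN
  have hN0 : 0 ≤ N := by positivity
  have hrank' : (Module.finrank ℂ L : ℝ) ≤ N + F.card := by
    rw [hN]; exact_mod_cast hrank
  rw [Real.mul_rpow hθ0.le hs.le] at hFcard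
  set a : ℝ := s ^ (-q) * m with ha
  have h1 : N ≤ 2 * θ * ((θ ^ (-q) * 2 ^ q) * a * LatticeL2.avgConst d ^ 2 * S₂) +
      θ * (4 * d ^ 2 * S₁) * (N / 2) := by
    refine le_of_mul_le_mul_right (hmain.trans_eq ?_) hs
    ring
  have h2 : θ * (4 * d ^ 2 * S₁) * (N / 2) ≤ 1 * (N / 2) := by gcongr
  have h3 : (Module.finrank ℂ L : ℝ) ≤ C * s ^ (-q) * m := by
    have : C * s ^ (-q) * m = θ ^ (-q) * s ^ (-q) * m +
        4 * θ * ((θ ^ (-q) * 2 ^ q) * a * LatticeL2.avgConst d ^ 2 * S₂) := by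
      rw [hC, ha]; ring
    rw [this]
    linarith
  rw [ENat.toENNReal_coe, ← ENNReal.ofReal_natCast]
  exact ENNReal.ofReal_le_ofReal h3
end
end

section
/- Let d ≥ 3 and V : ℤ^d → [0,∞). For every s > 0 and every finite subset E of {x ∈ ℤ^d : V(x) > 2sd}, there exists a finite-dimensional subspace L of F, consisting of finitely supported functions, with dim L ≥ 2^{−d} · card(E) and b_V[u] > s·Q_0[u] for every nonzero u ∈ L. Consequently n(s,V) ≥ 2^{−d} ν(2sd, V) for all s > 0. -/
open scoped ENNReal NNReal Topology
open Filter MeasureTheory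

noncomputable section

/-- The parity (sum of coordinates mod `2`) of a lattice point flips along each lattice edge. -/
theorem even_sum_add_latUnit {d : ℕ} (x : Fin d → ℤ) (j : Fin d) :
    Even (∑ i, (x + latUnit d j) i) ↔ ¬ Even (∑ i, x i) := by
  simp [latUnit, Finset.sum_add_distrib]

/-- If no lattice edge joins two points of the support of `u`, then `Q_0[u] = 2d‖u‖²`. -/
theorem Q0_eq_of_edge_free {d : ℕ} (u : (Fin d → ℤ) → ℂ)
    (hu : ∀ x j, u x = 0 ∨ u (x + latUnit d j) = 0) :
    Q0 u = 2 * d * ∑' x, (‖u x‖₊ : ℝ≥0∞) ^ 2 := by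
  have hedge : ∀ x j, (‖u (x + latUnit d j) - u x‖₊ : ℝ≥0∞) ^ 2 =
      (‖u (x + latUnit d j)‖₊ : ℝ≥0∞) ^ 2 + (‖u x‖₊ : ℝ≥0∞) ^ 2 := by
    intro x j
    rcases hu x j with h | h <;> simp [h]
  have hshift : ∀ j, ∑' x, (‖u (x + latUnit d j)‖₊ : ℝ≥0∞) ^ 2 =
      ∑' x, (‖u x‖₊ : ℝ≥0∞) ^ 2 := fun j =>
    (Equiv.addRight (latUnit d j)).tsum_eq fun x => (‖u x‖₊ : ℝ≥0∞) ^ 2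
  simp only [Q0, hedge]
  rw [Summable.tsum_finsetSum fun _ _ => ENNReal.summable]
  simp only [ENNReal.tsum_add, hshift, Finset.sum_const, Finset.card_univ, Fintype.card_fin,
    nsmul_eq_mul]
  ring

/-- A nonzero function supported in a finite subset of `{V > 2sd}` containing no lattice edge
satisfies `s·Q_0[u] < b_V[u]`. -/
theorem mul_Q0_lt_bV {d : ℕ} {V : (Fin d → ℤ) → ℝ} {s : ℝ} (hs : 0 < s)
    {E : Finset (Fin d → ℤ)} (hE : ∀ x ∈ E, 2 * s * d < V x)
    (hedge : ∀ x j, x ∈ E → x + latUnit d j ∉ E)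
    {u : (Fin d → ℤ) → ℂ} (hu : ∀ x ∉ E, u x = 0) (hu0 : u ≠ 0) :
    ENNReal.ofReal s * Q0 u < bV V u := by
  have hfree : ∀ x j, u x = 0 ∨ u (x + latUnit d j) = 0 := by
    intro x j
    by_cases hx : x ∈ E
    · exact Or.inr (hu _ (hedge x j hx))
    · exact Or.inl (hu x hx)
  have hQ : ENNReal.ofReal s * Q0 u =
      ∑' x, ENNReal.ofReal (2 * s * d) * (‖u x‖₊ : ℝ≥0∞) ^ 2 := by
    rw [Q0_eq_of_edge_free u hfree, ENNReal.tsum_mul_left, ← mul_assoc,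
      ENNReal.ofReal_mul (by positivity), ENNReal.ofReal_mul (by positivity)]
    simp only [ENNReal.ofReal_natCast, ENNReal.ofReal_ofNat]
    ring
  obtain ⟨y, hy⟩ := Function.ne_iff.mp hu0
  have hyE : y ∈ E := by
    by_contra h
    exact hy (hu y h)
  rw [hQ, bV]
  refine ENNReal.tsum_lt_tsum (i := y) ?_ ?_ ?_
  · rw [tsum_eq_sum (s := E) fun x hx => by simp [hu x hx]]
    exact ENNReal.sum_ne_top.mpr fun x _ =>
      ENNReal.mul_ne_top ENNReal.ofReal_ne_top (ENNReal.pow_ne_top ENNReal.coe_ne_top)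
  · intro x
    by_cases hx : x ∈ E
    · have := (hE x hx).le
      gcongr
    · simp [hu x hx]
  · have hyn : (‖u y‖₊ : ℝ≥0∞) ^ 2 ≠ 0 := by simpa using hy
    have hV : ENNReal.ofReal (2 * s * d) < ENNReal.ofReal (V y) :=
      (ENNReal.ofReal_lt_ofReal_iff_of_nonneg (by positivity)).mpr (hE y hyE)
    exact (ENNReal.mul_lt_mul_iff_left hyn (ENNReal.pow_ne_top ENNReal.coe_ne_top)).mpr hV

/-- A finite set of lattice points has a subset of at least half its size with no lattice edge. -/
theorem exists_edge_free_subset {d : ℕ} (E : Finset (Fin d → ℤ)) :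
    ∃ F ⊆ E, (∀ x j, x ∈ F → x + latUnit d j ∉ F) ∧ E.card ≤ 2 * F.card := by
  have hcard := Finset.card_filter_add_card_filter_not (s := E) fun x => Even (∑ i, x i)
  rcases le_total (E.filter fun x => Even (∑ i, x i)).card
    (E.filter fun x => ¬ Even (∑ i, x i)).card with h | h
  · refine ⟨E.filter fun x => ¬ Even (∑ i, x i), Finset.filter_subset _ _, ?_, by omega⟩
    intro x j hx hx'
    rw [Finset.mem_filter] at hx hx'
    exact hx'.2 ((even_sum_add_latUnit x j).mpr hx.2)
  · refine ⟨E.filter fun x => Even (∑ i, x i), Finset.filter_subset _ _, ?_, by omega⟩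
    intro x j hx hx'
    rw [Finset.mem_filter] at hx hx'
    exact (even_sum_add_latUnit x j).mp hx'.2 hx.2

/-- Functions supported in a finite set `F` form a subspace of dimension `card F`. -/
theorem exists_submodule_supported {α : Type*} (F : Finset α) :
    ∃ L : Submodule ℂ (α → ℂ), (∀ u ∈ L, ∀ x ∉ F, u x = 0) ∧ FiniteDimensional ℂ L ∧
      Module.finrank ℂ L = F.card := by
  let f := Function.ExtendByZero.linearMap ℂ (Subtype.val : F → α)
  have hf : Function.Injective f := by
    intro v w h
    funext i
    simpa [f, Subtype.val_injective.extend_apply] using congrFun h i.1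
  refine ⟨LinearMap.range f, ?_, inferInstance, ?_⟩
  · rintro _ ⟨v, rfl⟩ x hx
    exact Function.extend_apply' _ _ _ fun ⟨i, hi⟩ => hx (hi ▸ i.2)
  · rw [LinearMap.finrank_range_of_inj hf]
    simp

/-- Any finite subset `E` of `{V > 2sd}` yields an `s`-admissible subspace of dimension at least
`2^{−d} card E`. -/
theorem exists_admissible_subspace {d : ℕ} (hd : d ≠ 0) {V : (Fin d → ℤ) → ℝ} {s : ℝ}
    (hs : 0 < s) (E : Finset (Fin d → ℤ)) (hE : ∀ x ∈ E, 2 * s * d < V x) :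
    ∃ L : Submodule ℂ ((Fin d → ℤ) → ℂ),
      (∀ u ∈ L, (Function.support u).Finite) ∧ FiniteDimensional ℂ L ∧
      (∀ u ∈ L, u ≠ 0 → ENNReal.ofReal s * Q0 u < bV V u) ∧
      E.card ≤ 2 ^ d * Module.finrank ℂ L := by
  obtain ⟨F, hFE, hedge, hcard⟩ := exists_edge_free_subset E
  obtain ⟨L, hL, hfin, hrank⟩ := exists_submodule_supported F
  refine ⟨L, ?_, hfin, ?_, ?_⟩
  · intro u hu
    refine F.finite_toSet.subset fun x hx => ?_
    by_contra h
    exact hx (hL u hu x h)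
  · exact fun u hu => mul_Q0_lt_bV hs (fun x hx => hE x (hFE hx)) hedge (hL u hu)
  · rw [hrank]
    exact hcard.trans (Nat.mul_le_mul_right _ (le_self_pow₀ (by norm_num) hd))

/-- lower bound `n(s,V) ≥ 2^{−d} ν(2sd,V)`, via an explicit admissible
subspace of dimension at least `2^{−d} card E` for any finite `E ⊆ {V > 2sd}`. -/
theorem lower_bound_nu (d : ℕ) (hd : 3 ≤ d) (V : (Fin d → ℤ) → ℝ)
    (hV : ∀ x, 0 ≤ V x) (s : ℝ) (hs : 0 < s) (E : Finset (Fin d → ℤ))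
    (hE : ∀ x ∈ E, 2 * s * d < V x) :
    (∃ L : Submodule ℂ ((Fin d → ℤ) → ℂ),
        (∀ u ∈ L, (Function.support u).Finite) ∧ FiniteDimensional ℂ L ∧
        (∀ u ∈ L, u ≠ 0 → ENNReal.ofReal s * Q0 u < bV V u) ∧
        E.card ≤ 2 ^ d * Module.finrank ℂ L) ∧
      nuCount d V (2 * s * d) ≤ 2 ^ d * nCount d V s := by
  refine ⟨exists_admissible_subspace (by omega) hs E hE, ?_⟩
  refine ENat.forall_natCast_le_iff_le.mp fun k hk => ?_
  obtain ⟨T, hTV, hT⟩ := Set.exists_subset_encard_eq hk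
  lift T to Finset (Fin d → ℤ) using Set.finite_of_encard_eq_coe hT
  obtain ⟨L, hsupp, hfin, hadm, hcard⟩ :=
    exists_admissible_subspace (by omega) hs T fun x hx => hTV hx
  rw [← hT, Set.encard_coe_eq_coe_finsetCard]
  calc (T.card : ℕ∞) ≤ 2 ^ d * (Module.finrank ℂ L : ℕ∞) := by exact_mod_cast hcard
    _ ≤ 2 ^ d * nCount d V s := by
      gcongr
      exact le_iSup (fun L : {L : Submodule ℂ ((Fin d → ℤ) → ℂ) //
        (∀ u ∈ L, (Function.support u).Finite) ∧ FiniteDimensional ℂ L ∧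
        ∀ u ∈ L, u ≠ 0 → ENNReal.ofReal s * Q0 u < bV V u} => (Module.finrank ℂ L.1 : ℕ∞))
        ⟨L, hsupp, hfin, hadm⟩
end
end
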